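/- arXiv:2412.01732 — 3 statements merged into one kernel-verified Lean document; each statement's English description precedes it below -/
import Mathlib

section
/- Weak entropy factorization: for states ρ, σ on H_A ⊗ H_B ⊗ H_C ⊗ H_D with σ full rank, the conditional relative entropies satisfy D_{ABC}(ρ‖σ) ≤ D_{AB}(ρ‖σ) + D_{BC}(ρ‖σ) + ‖log σ_{ACD} + log σ_D − log σ_{AD} − log σ_{CD}‖_∞. -/
open scoped BigOperators Matrix Classical ComplexOrder

noncomputable section

namespace Paper

variable {n : Type*} [Fintype n] [DecidableEq n]

/-- Operator (spectral) norm of a matrix, via the Euclidean operator norm. -/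
def opNorm (A : Matrix n n ℂ) : ℝ :=
  ‖LinearMap.toContinuousLinearMap (Matrix.toEuclideanLin A)‖

/-- Functional calculus on Hermitian matrices (returns `0` on non-Hermitian input). -/
def matFun (f : ℝ → ℝ) (A : Matrix n n ℂ) : Matrix n n ℂ :=
  if h : A.IsHermitian then
    (h.eigenvectorUnitary : Matrix n n ℂ) *
      Matrix.diagonal (fun i => (f (h.eigenvalues i) : ℂ)) *
      (star h.eigenvectorUnitary : Matrix n n ℂ)
  else 0

/-- Matrix logarithm (spectral). -/
def matLog (A : Matrix n n ℂ) : Matrix n n ℂ := matFun Real.log A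

/-- Matrix exponential (spectral, for Hermitian matrices). -/
def matExp (A : Matrix n n ℂ) : Matrix n n ℂ := matFun Real.exp A

/-- Trace norm (of a Hermitian matrix: the sum of absolute values of eigenvalues). -/
def traceNorm (A : Matrix n n ℂ) : ℝ :=
  if h : A.IsHermitian then ∑ i, |h.eigenvalues i| else 0

/-- Umegaki relative entropy `D(ρ‖σ) = Tr[ρ(log ρ − log σ)]`. -/
def relEnt (ρ σ : Matrix n n ℂ) : ℝ :=
  (Matrix.trace (ρ * (matLog ρ - matLog σ))).re

/-- von Neumann entropy. -/
def vnEnt (ρ : Matrix n n ℂ) : ℝ := -(Matrix.trace (ρ * matLog ρ)).re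

/-- A quantum state: positive semidefinite with unit trace. -/
def IsState (ρ : Matrix n n ℂ) : Prop := ρ.PosSemidef ∧ ρ.trace = 1

/-- Entropy production of a generator `L` with respect to the reference state `σ`. -/
def entProd (L : Matrix n n ℂ → Matrix n n ℂ) (σ ρ : Matrix n n ℂ) : ℝ :=
  -(Matrix.trace (L ρ * (matLog ρ - matLog σ))).re

end Paper
namespace Paper

variable {ιA ιB ιC ιD : Type*} [Fintype ιA] [Fintype ιB] [Fintype ιC] [Fintype ιD]
  [DecidableEq ιA] [DecidableEq ιB] [DecidableEq ιC] [DecidableEq ιD]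

/-- Marginal of a four-partite operator on the subsystem `ACD`. -/
def margACD (ρ : Matrix (ιA × ιB × ιC × ιD) (ιA × ιB × ιC × ιD) ℂ) :
    Matrix (ιA × ιC × ιD) (ιA × ιC × ιD) ℂ :=
  fun x y => ∑ b : ιB, ρ (x.1, b, x.2.1, x.2.2) (y.1, b, y.2.1, y.2.2)

/-- Marginal on `AD`. -/
def margAD (ρ : Matrix (ιA × ιB × ιC × ιD) (ιA × ιB × ιC × ιD) ℂ) :
    Matrix (ιA × ιD) (ιA × ιD) ℂ :=
  fun x y => ∑ b : ιB, ∑ c : ιC, ρ (x.1, b, c, x.2) (y.1, b, c, y.2)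

/-- Marginal on `CD`. -/
def margCD (ρ : Matrix (ιA × ιB × ιC × ιD) (ιA × ιB × ιC × ιD) ℂ) :
    Matrix (ιC × ιD) (ιC × ιD) ℂ :=
  fun x y => ∑ a : ιA, ∑ b : ιB, ρ (a, b, x.1, x.2) (a, b, y.1, y.2)

/-- Marginal on `D`. -/
def margD (ρ : Matrix (ιA × ιB × ιC × ιD) (ιA × ιB × ιC × ιD) ℂ) :
    Matrix ιD ιD ℂ :=
  fun x y => ∑ a : ιA, ∑ b : ιB, ∑ c : ιC, ρ (a, b, c, x) (a, b, c, y)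

/-- Embedding of an operator on `D` into `ACD` (tensoring with identities). -/
def embD (M : Matrix ιD ιD ℂ) : Matrix (ιA × ιC × ιD) (ιA × ιC × ιD) ℂ :=
  fun x y => if x.1 = y.1 ∧ x.2.1 = y.2.1 then M x.2.2 y.2.2 else 0

/-- Embedding of an operator on `AD` into `ACD`. -/
def embAD (M : Matrix (ιA × ιD) (ιA × ιD) ℂ) : Matrix (ιA × ιC × ιD) (ιA × ιC × ιD) ℂ :=
  fun x y => if x.2.1 = y.2.1 then M (x.1, x.2.2) (y.1, y.2.2) else 0

/-- Embedding of an operator on `CD` into `ACD`. -/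
def embCD (M : Matrix (ιC × ιD) (ιC × ιD) ℂ) : Matrix (ιA × ιC × ιD) (ιA × ιC × ιD) ℂ :=
  fun x y => if x.1 = y.1 then M x.2 y.2 else 0

/-- The matrix-valued quantum conditional mutual information
`H_σ(A:C|D) = log σ_{ACD} + log σ_D − log σ_{AD} − log σ_{CD}`, as an operator on `ACD`. -/
def mcmi (σ : Matrix (ιA × ιB × ιC × ιD) (ιA × ιB × ιC × ιD) ℂ) :
    Matrix (ιA × ιC × ιD) (ιA × ιC × ιD) ℂ :=
  matLog (margACD σ) + embD (matLog (margD σ)) - embAD (matLog (margAD σ))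
    - embCD (matLog (margCD σ))

end Paper
namespace Paper

/-- Conditional relative entropy `D_R(ρ‖σ) = D(ρ‖σ) − D(ρ_{R̄}‖σ_{R̄})` where the partial
trace onto the complement `R̄` is supplied explicitly. -/
def condRelEnt {n m : Type*} [Fintype n] [DecidableEq n] [Fintype m] [DecidableEq m]
    (ρ σ : Matrix n n ℂ) (ptr : Matrix n n ℂ → Matrix m m ℂ) : ℝ :=
  relEnt ρ σ - relEnt (ptr ρ) (ptr σ)

lemma trace_two_diag {n : Type*} [Fintype n] [DecidableEq n] (W : Matrix n n ℂ) (r s : n → ℝ) :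
    Matrix.trace (Matrix.diagonal (fun i => (s i : ℂ)) * W * Matrix.diagonal (fun i => (r i : ℂ)) * Wᴴ)
      = ((∑ i, ∑ j, s i * (r j * ‖W i j‖ ^ 2) : ℝ) : ℂ) := by
  simp only [Matrix.trace, Matrix.diag_apply, Matrix.mul_apply (N := Wᴴ), Matrix.mul_diagonal,
    Matrix.diagonal_mul, Matrix.conjTranspose_apply]
  push_cast
  refine Finset.sum_congr rfl fun i _ => Finset.sum_congr rfl fun j _ => ?_
  have : W i j * star (W i j) = (‖W i j‖ : ℂ) ^ 2 := by
    rw [RCLike.star_def, RCLike.mul_conj]; rfl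
  rw [← this]; ring

lemma matFun_of_herm {n : Type*} [Fintype n] [DecidableEq n] {A : Matrix n n ℂ}
    (h : A.IsHermitian) (f : ℝ → ℝ) : matFun f A =
    (h.eigenvectorUnitary : Matrix n n ℂ) *
      Matrix.diagonal (fun i => (f (h.eigenvalues i) : ℂ)) *
      (h.eigenvectorUnitary : Matrix n n ℂ)ᴴ := by
  unfold matFun; rw [dif_pos h]; rfl

lemma matFun_eq_cfc {n : Type*} [Fintype n] [DecidableEq n] {A : Matrix n n ℂ}
    (h : A.IsHermitian) (f : ℝ → ℝ) : matFun f A = cfc f A := by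
  rw [matFun_of_herm h, h.cfc_eq]; rfl

lemma spec_eq {n : Type*} [Fintype n] [DecidableEq n] {A : Matrix n n ℂ}
    (h : A.IsHermitian) : A =
    (h.eigenvectorUnitary : Matrix n n ℂ) *
      Matrix.diagonal (fun i => (h.eigenvalues i : ℂ)) *
      (h.eigenvectorUnitary : Matrix n n ℂ)ᴴ := by
  conv_lhs => rw [h.spectral_theorem]
  rfl

lemma unit_mul {n : Type*} [Fintype n] [DecidableEq n] {A : Matrix n n ℂ}
    (h : A.IsHermitian) : (h.eigenvectorUnitary : Matrix n n ℂ)ᴴ * (h.eigenvectorUnitary : Matrix n n ℂ) = 1 :=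
  Unitary.coe_star_mul_self h.eigenvectorUnitary

lemma mul_unit {n : Type*} [Fintype n] [DecidableEq n] {A : Matrix n n ℂ}
    (h : A.IsHermitian) : (h.eigenvectorUnitary : Matrix n n ℂ) * (h.eigenvectorUnitary : Matrix n n ℂ)ᴴ = 1 :=
  Unitary.coe_mul_star_self h.eigenvectorUnitary

/-- overlap matrix between eigenbases -/
def ov {n : Type*} [Fintype n] [DecidableEq n] {ρ σ : Matrix n n ℂ}
    (hρ : ρ.IsHermitian) (hσ : σ.IsHermitian) : Matrix n n ℂ :=
  (hσ.eigenvectorUnitary : Matrix n n ℂ)ᴴ * (hρ.eigenvectorUnitary : Matrix n n ℂ)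

lemma ov_col {n : Type*} [Fintype n] [DecidableEq n] {ρ σ : Matrix n n ℂ}
    (hρ : ρ.IsHermitian) (hσ : σ.IsHermitian) (j : n) : ∑ i, ‖ov hρ hσ i j‖ ^ 2 = 1 := by
  have h : (ov hρ hσ)ᴴ * ov hρ hσ = 1 := by
    unfold ov
    rw [Matrix.conjTranspose_mul, Matrix.conjTranspose_conjTranspose, Matrix.mul_assoc,
      ← Matrix.mul_assoc (hσ.eigenvectorUnitary : Matrix n n ℂ), mul_unit hσ, Matrix.one_mul,
      unit_mul]
  have h2 := congrFun (congrFun h j) j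
  rw [Matrix.mul_apply, Matrix.one_apply_eq] at h2
  have h3 : ((∑ i, ‖ov hρ hσ i j‖ ^ 2 : ℝ) : ℂ) = 1 := by
    rw [← h2]; push_cast
    refine Finset.sum_congr rfl fun i _ => ?_
    rw [Matrix.conjTranspose_apply, RCLike.star_def, RCLike.conj_mul]; rfl
  exact_mod_cast h3

lemma trace_mul_matFun_self {n : Type*} [Fintype n] [DecidableEq n] {ρ : Matrix n n ℂ}
    (hρ : ρ.IsHermitian) (f : ℝ → ℝ) :
    (ρ * matFun f ρ).trace = ((∑ j, hρ.eigenvalues j * f (hρ.eigenvalues j) : ℝ) : ℂ) := by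
  rw [matFun_of_herm hρ]
  conv_lhs => enter [1, 1]; rw [spec_eq hρ]
  set U := (hρ.eigenvectorUnitary : Matrix n n ℂ)
  have hU : Uᴴ * U = 1 := unit_mul hρ
  set E := Matrix.diagonal (fun i => (hρ.eigenvalues i : ℂ))
  set F := Matrix.diagonal (fun i => (f (hρ.eigenvalues i) : ℂ))
  have : U * E * Uᴴ * (U * F * Uᴴ) = U * (E * F * Uᴴ) := by
    calc _ = U * E * (Uᴴ * U) * (F * Uᴴ) := by simp only [Matrix.mul_assoc]
      _ = _ := by rw [hU]; simp only [Matrix.mul_assoc, Matrix.one_mul]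
  rw [this, Matrix.trace_mul_comm, Matrix.mul_assoc, hU, Matrix.mul_one, Matrix.diagonal_mul_diagonal,
    Matrix.trace_diagonal]
  push_cast; rfl

lemma trace_mul_matFun {n : Type*} [Fintype n] [DecidableEq n] {ρ σ : Matrix n n ℂ}
    (hρ : ρ.IsHermitian) (hσ : σ.IsHermitian) (f : ℝ → ℝ) :
    (ρ * matFun f σ).trace =
      ((∑ i, ∑ j, f (hσ.eigenvalues i) * (hρ.eigenvalues j * ‖ov hρ hσ i j‖ ^ 2) : ℝ) : ℂ) := by
  rw [← trace_two_diag, matFun_of_herm hσ]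
  conv_lhs => enter [1, 1]; rw [spec_eq hρ]
  unfold ov
  rw [Matrix.conjTranspose_mul, Matrix.conjTranspose_conjTranspose]
  rw [Matrix.trace_mul_comm]
  simp only [Matrix.mul_assoc]
  rw [Matrix.trace_mul_comm]
  simp only [Matrix.mul_assoc]

lemma relEnt_formula {n : Type*} [Fintype n] [DecidableEq n] {ρ σ : Matrix n n ℂ}
    (hρ : ρ.IsHermitian) (hσ : σ.IsHermitian) :
    relEnt ρ σ = ∑ i, ∑ j, ‖ov hρ hσ i j‖ ^ 2 * (hρ.eigenvalues j *
      (Real.log (hρ.eigenvalues j) - Real.log (hσ.eigenvalues i))) := by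
  unfold relEnt matLog
  rw [Matrix.mul_sub, Matrix.trace_sub, trace_mul_matFun_self hρ, trace_mul_matFun hρ hσ,
    ← Complex.ofReal_sub, Complex.ofReal_re]
  have : ∑ j, hρ.eigenvalues j * Real.log (hρ.eigenvalues j) = ∑ i, ∑ j, ‖ov hρ hσ i j‖ ^ 2 *
      (hρ.eigenvalues j * Real.log (hρ.eigenvalues j)) := by
    rw [Finset.sum_comm]
    refine Finset.sum_congr rfl fun j _ => ?_
    rw [← Finset.sum_mul, ov_col, one_mul]
  rw [this, ← Finset.sum_sub_distrib]
  refine Finset.sum_congr rfl fun i _ => ?_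
  rw [← Finset.sum_sub_distrib]
  refine Finset.sum_congr rfl fun j _ => ?_
  ring

/-- resolvent functional -/
def Qf {n : Type*} [Fintype n] [DecidableEq n] {ρ σ : Matrix n n ℂ}
    (hρ : ρ.IsHermitian) (hσ : σ.IsHermitian) (t : ℝ) : ℝ :=
  ∑ i, ∑ j, ‖ov hρ hσ i j‖ ^ 2 * (hρ.eigenvalues j *
    (hρ.eigenvalues j / (hσ.eigenvalues i + t * hρ.eigenvalues j)))

/-- quadratic functional -/
def Vf {n : Type*} [Fintype n] [DecidableEq n] (ρ σ : Matrix n n ℂ) (t : ℝ) (X : Matrix n n ℂ) : ℝ :=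
  2 * (ρ * Xᴴ).trace.re - (σ * (X * Xᴴ)).trace.re - t * (ρ * (Xᴴ * X)).trace.re

lemma Vf_formula {n : Type*} [Fintype n] [DecidableEq n] {ρ σ : Matrix n n ℂ}
    (hρ : ρ.IsHermitian) (hσ : σ.IsHermitian) (t : ℝ) (Y : Matrix n n ℂ) :
    Vf ρ σ t ((hσ.eigenvectorUnitary : Matrix n n ℂ) * Y * (hρ.eigenvectorUnitary : Matrix n n ℂ)ᴴ)
     = ∑ i, ∑ j, (2 * hρ.eigenvalues j * (ov hρ hσ i j * star (Y i j)).re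
        - (hσ.eigenvalues i + t * hρ.eigenvalues j) * ‖Y i j‖ ^ 2) := by
  have hU := unit_mul hρ
  have hV := unit_mul hσ
  have e1 := spec_eq hρ
  have e2 := spec_eq hσ
  set W := ov hρ hσ with hW
  unfold ov at hW
  set U := (hρ.eigenvectorUnitary : Matrix n n ℂ)
  set V := (hσ.eigenvectorUnitary : Matrix n n ℂ)
  set E := Matrix.diagonal (fun i => (hρ.eigenvalues i : ℂ)) with hE
  set F := Matrix.diagonal (fun i => (hσ.eigenvalues i : ℂ)) with hF
  have t1 : (ρ * (V * Y * Uᴴ)ᴴ).trace = (W * E * Yᴴ).trace := by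
    rw [e1, hW]
    simp only [Matrix.conjTranspose_mul, Matrix.conjTranspose_conjTranspose]
    calc _ = (U * E * (Uᴴ * U) * (Yᴴ * Vᴴ)).trace := by simp only [Matrix.mul_assoc]
      _ = ((U * E * Yᴴ) * Vᴴ).trace := by rw [hU]; simp only [Matrix.mul_assoc, Matrix.one_mul]
      _ = _ := by rw [Matrix.trace_mul_comm]; simp only [Matrix.mul_assoc]
  have t2 : (σ * ((V * Y * Uᴴ) * (V * Y * Uᴴ)ᴴ)).trace = (F * Y * 1 * Yᴴ).trace := by
    rw [e2]
    simp only [Matrix.conjTranspose_mul, Matrix.conjTranspose_conjTranspose]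
    calc _ = (V * F * (Vᴴ * V) * Y * (Uᴴ * U) * Yᴴ * Vᴴ).trace := by simp only [Matrix.mul_assoc]
      _ = (V * F * 1 * Y * 1 * Yᴴ * Vᴴ).trace := by rw [hU, hV]
      _ = (Vᴴ * V * (F * 1 * Y * 1 * Yᴴ)).trace := by
        rw [Matrix.trace_mul_comm]; simp only [Matrix.mul_assoc]
      _ = _ := by rw [hV]; simp only [Matrix.mul_assoc, Matrix.one_mul]
  have t3 : (ρ * ((V * Y * Uᴴ)ᴴ * (V * Y * Uᴴ))).trace = (1 * Y * E * Yᴴ).trace := by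
    rw [e1]
    simp only [Matrix.conjTranspose_mul, Matrix.conjTranspose_conjTranspose]
    calc _ = (U * E * (Uᴴ * U) * Yᴴ * (Vᴴ * V) * Y * Uᴴ).trace := by simp only [Matrix.mul_assoc]
      _ = (U * (E * Yᴴ * Y * Uᴴ)).trace := by
        rw [hU, hV]; simp only [Matrix.mul_assoc, Matrix.one_mul]
      _ = (E * Yᴴ * Y * (Uᴴ * U)).trace := by
        rw [Matrix.trace_mul_comm]; simp only [Matrix.mul_assoc]
      _ = _ := by
        rw [hU, Matrix.mul_one, Matrix.trace_mul_comm, Matrix.one_mul]; simp only [Matrix.mul_assoc]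
  have o1 : (1 : Matrix n n ℂ) = Matrix.diagonal (fun _ => ((1 : ℝ) : ℂ)) := by simp
  unfold Vf
  rw [t1, t2, t3, o1, hE, hF, trace_two_diag, trace_two_diag, Complex.ofReal_re, Complex.ofReal_re]
  have t4 : (W * Matrix.diagonal (fun i => (hρ.eigenvalues i : ℂ)) * Yᴴ).trace.re
      = ∑ i, ∑ j, hρ.eigenvalues j * (W i j * star (Y i j)).re := by
    simp only [Matrix.trace, Matrix.diag_apply, Matrix.mul_apply (N := Yᴴ), Matrix.mul_diagonal,
      Matrix.conjTranspose_apply, Complex.re_sum]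
    refine Finset.sum_congr rfl fun i _ => Finset.sum_congr rfl fun j _ => ?_
    rw [← Complex.re_ofReal_mul]; congr 1; ring
  rw [t4]
  simp only [Finset.mul_sum, ← Finset.sum_sub_distrib]
  refine Finset.sum_congr rfl fun i _ => Finset.sum_congr rfl fun j _ => ?_
  ring

lemma scalar_var (w y : ℂ) (r a : ℝ) (ha : 0 < a) :
    2 * r * (w * star y).re - a * ‖y‖ ^ 2 ≤ ‖w‖ ^ 2 * (r * (r / a)) := by
  have h : 0 ≤ a⁻¹ * ‖(a : ℂ) * y - (r : ℂ) * w‖ ^ 2 := by positivity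
  have e : ‖w‖ ^ 2 * (r * (r / a)) - (2 * r * (w * star y).re - a * ‖y‖ ^ 2)
      = a⁻¹ * ‖(a : ℂ) * y - (r : ℂ) * w‖ ^ 2 := by
    simp only [← Complex.normSq_eq_norm_sq, Complex.normSq_apply, Complex.sub_re, Complex.sub_im,
      Complex.mul_im, Complex.ofReal_re, Complex.ofReal_im, Complex.mul_re, RCLike.star_def,
      Complex.conj_re, Complex.conj_im]
    field_simp
    ring
  linarith

lemma scalar_var_eq (w : ℂ) (r a : ℝ) (ha : 0 < a) :
    2 * r * (w * star (((r / a : ℝ) : ℂ) * w)).re - a * ‖((r / a : ℝ) : ℂ) * w‖ ^ 2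
      = ‖w‖ ^ 2 * (r * (r / a)) := by
  simp only [← Complex.normSq_eq_norm_sq, Complex.normSq_apply,
      Complex.mul_im, Complex.ofReal_re, Complex.ofReal_im, Complex.mul_re, RCLike.star_def,
      Complex.conj_re, Complex.conj_im]
  field_simp
  ring

lemma Vf_le_Qf {n : Type*} [Fintype n] [DecidableEq n] {ρ σ : Matrix n n ℂ}
    (hρ : ρ.PosSemidef) (hσ : σ.PosDef) {t : ℝ} (ht : 0 ≤ t) (X : Matrix n n ℂ) :
    Vf ρ σ t X ≤ Qf hρ.isHermitian hσ.isHermitian t := by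
  have hX : X = (hσ.isHermitian.eigenvectorUnitary : Matrix n n ℂ) *
      ((hσ.isHermitian.eigenvectorUnitary : Matrix n n ℂ)ᴴ * X *
        (hρ.isHermitian.eigenvectorUnitary : Matrix n n ℂ)) *
      (hρ.isHermitian.eigenvectorUnitary : Matrix n n ℂ)ᴴ := by
    rw [Matrix.mul_assoc, Matrix.mul_assoc, mul_unit, Matrix.mul_one, ← Matrix.mul_assoc, mul_unit,
      Matrix.one_mul]
  rw [hX, Vf_formula]
  unfold Qf
  refine Finset.sum_le_sum fun i _ => Finset.sum_le_sum fun j _ => scalar_var _ _ _ _ ?_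
  have := hσ.eigenvalues_pos i
  have := hρ.eigenvalues_nonneg j
  positivity

lemma exists_Vf_eq_Qf {n : Type*} [Fintype n] [DecidableEq n] {ρ σ : Matrix n n ℂ}
    (hρ : ρ.PosSemidef) (hσ : σ.PosDef) {t : ℝ} (ht : 0 ≤ t) :
    ∃ X, Vf ρ σ t X = Qf hρ.isHermitian hσ.isHermitian t := by
  refine ⟨_, Vf_formula hρ.isHermitian hσ.isHermitian t (Matrix.of fun i j =>
    (((hρ.isHermitian.eigenvalues j / (hσ.isHermitian.eigenvalues i + t * hρ.isHermitian.eigenvalues j) : ℝ) : ℂ) *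
      ov hρ.isHermitian hσ.isHermitian i j)) |>.trans ?_⟩
  unfold Qf
  refine Finset.sum_congr rfl fun i _ => Finset.sum_congr rfl fun j _ => scalar_var_eq _ _ _ ?_
  have := hσ.eigenvalues_pos i
  have := hρ.eigenvalues_nonneg j
  positivity

/-- log functional with cutoff -/
def Gf {n : Type*} [Fintype n] [DecidableEq n] {ρ σ : Matrix n n ℂ}
    (hρ : ρ.IsHermitian) (hσ : σ.IsHermitian) (t : ℝ) : ℝ :=
  ∑ i, ∑ j, ‖ov hρ hσ i j‖ ^ 2 * (hρ.eigenvalues j *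
    (Real.log (hσ.eigenvalues i + t * hρ.eigenvalues j) - Real.log (hσ.eigenvalues i)))

lemma Gf_deriv {n : Type*} [Fintype n] [DecidableEq n] {ρ σ : Matrix n n ℂ}
    (hρ : ρ.PosSemidef) (hσ : σ.PosDef) {t : ℝ} (ht : 0 ≤ t) :
    HasDerivAt (Gf hρ.isHermitian hσ.isHermitian) (Qf hρ.isHermitian hσ.isHermitian t) t := by
  unfold Gf Qf
  refine HasDerivAt.fun_sum fun i _ => HasDerivAt.fun_sum fun j _ => ?_
  refine HasDerivAt.const_mul _ (HasDerivAt.const_mul _ (HasDerivAt.sub_const _ ?_))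
  have := hσ.eigenvalues_pos i
  have := hρ.eigenvalues_nonneg j
  refine HasDerivAt.log ?_ (by positivity)
  simpa using ((hasDerivAt_id t).mul_const (hρ.isHermitian.eigenvalues j)).const_add
    (hσ.isHermitian.eigenvalues i)

lemma sum_weights {n : Type*} [Fintype n] [DecidableEq n] {ρ σ : Matrix n n ℂ}
    (hρ : ρ.IsHermitian) (hσ : σ.IsHermitian) :
    ∑ i, ∑ j, ‖ov hρ hσ i j‖ ^ 2 * hρ.eigenvalues j = ρ.trace.re := by
  rw [Finset.sum_comm]
  simp only [← Finset.sum_mul, ov_col, one_mul]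
  rw [hρ.trace_eq_sum_eigenvalues, Complex.re_sum]
  rfl

lemma Gf_tendsto {n : Type*} [Fintype n] [DecidableEq n] {ρ σ : Matrix n n ℂ}
    (hρ : ρ.PosSemidef) (hσ : σ.PosDef) :
    Filter.Tendsto (fun t => Gf hρ.isHermitian hσ.isHermitian t - ρ.trace.re * Real.log t)
      Filter.atTop (nhds (relEnt ρ σ)) := by
  rw [relEnt_formula hρ.isHermitian hσ.isHermitian, ← sum_weights hρ.isHermitian hσ.isHermitian]
  unfold Gf
  simp only [Finset.sum_mul, ← Finset.sum_sub_distrib]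
  refine tendsto_finsetSum _ fun i _ => tendsto_finsetSum _ fun j _ => ?_
  have hs := hσ.eigenvalues_pos i
  have hr := hρ.eigenvalues_nonneg j
  set r := hρ.isHermitian.eigenvalues j
  set s := hσ.isHermitian.eigenvalues i
  rcases hr.eq_or_lt with h0 | h0
  · simp [← h0]
  · have : Filter.Tendsto (fun t : ℝ => ‖ov hρ.isHermitian hσ.isHermitian i j‖ ^ 2 *
        (r * (Real.log (s / t + r) - Real.log s))) Filter.atTop
        (nhds (‖ov hρ.isHermitian hσ.isHermitian i j‖ ^ 2 * (r * (Real.log r - Real.log s)))) := by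
      refine Filter.Tendsto.const_mul _ (Filter.Tendsto.const_mul _ (Filter.Tendsto.sub_const ?_ _))
      refine Filter.Tendsto.log ?_ h0.ne'
      simpa using (Filter.Tendsto.const_div_atTop Filter.tendsto_id s).add_const r
    refine this.congr' ?_
    filter_upwards [Filter.eventually_gt_atTop 0] with t ht
    have : s + t * r = t * (s / t + r) := by field_simp
    rw [this, Real.log_mul ht.ne' (by positivity)]
    ring

/-- Data processing inequality for the restriction dual to a star-homomorphism. -/
theorem dpi {n m : Type*} [Fintype n] [DecidableEq n] [Fintype m] [DecidableEq m]
    (Φ : Matrix m m ℂ →⋆ₐ[ℂ] Matrix n n ℂ) {ρ σ : Matrix n n ℂ} {ρ' σ' : Matrix m m ℂ}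
    (hρ : ρ.PosSemidef) (hσ : σ.PosDef) (hρ' : ρ'.PosSemidef) (hσ' : σ'.PosDef)
    (h1 : ∀ X, (ρ * Φ X).trace = (ρ' * X).trace) (h2 : ∀ X, (σ * Φ X).trace = (σ' * X).trace) :
    relEnt ρ' σ' ≤ relEnt ρ σ := by
  have hQ : ∀ t, 0 ≤ t → Qf hρ'.isHermitian hσ'.isHermitian t ≤ Qf hρ.isHermitian hσ.isHermitian t := by
    intro t ht
    obtain ⟨X, hX⟩ := exists_Vf_eq_Qf hρ' hσ' ht
    rw [← hX]
    refine le_trans (le_of_eq ?_) (Vf_le_Qf hρ hσ ht (Φ X))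
    have hs : (Φ X)ᴴ = Φ Xᴴ := (map_star Φ X).symm
    unfold Vf
    rw [hs, ← map_mul, ← map_mul, h1, h1, h2]
  have htr : ρ.trace = ρ'.trace := by simpa using h1 1
  have hmono : MonotoneOn (fun t => Gf hρ.isHermitian hσ.isHermitian t -
      Gf hρ'.isHermitian hσ'.isHermitian t) (Set.Ici 0) := by
    have hd : ∀ t, 0 ≤ t → HasDerivAt (fun t => Gf hρ.isHermitian hσ.isHermitian t -
      Gf hρ'.isHermitian hσ'.isHermitian t) _ t := fun t ht =>
        (Gf_deriv hρ hσ ht).sub (Gf_deriv hρ' hσ' ht)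
    refine monotoneOn_of_deriv_nonneg (convex_Ici 0)
      (fun t ht => (hd t ht).continuousAt.continuousWithinAt) (fun t ht => ?_) (fun t ht => ?_)
    · exact (hd t (interior_subset ht)).differentiableAt.differentiableWithinAt
    · rw [(hd t (interior_subset ht)).deriv]
      exact sub_nonneg.2 (hQ t (interior_subset ht))
  refine le_of_tendsto_of_tendsto (Gf_tendsto hρ' hσ') (Gf_tendsto hρ hσ) ?_
  filter_upwards [Filter.eventually_ge_atTop 0] with t ht
  have h := hmono (Set.mem_Ici.2 le_rfl) (Set.mem_Ici.2 ht) ht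
  simp only [Gf, zero_mul, add_zero, sub_self, mul_zero, Finset.sum_const_zero] at h
  rw [htr]
  simp only [Gf]
  linarith

/-- embedding `M ↦ M ⊗ 1` along a factorization `n ≃ m × k` -/
def emb {n m k : Type*} [Fintype n] [DecidableEq n] [Fintype m] [DecidableEq m] [Fintype k]
    [DecidableEq k] (e : n ≃ m × k) : Matrix m m ℂ →⋆ₐ[ℂ] Matrix n n ℂ where
  toFun M := Matrix.of fun x y => if (e x).2 = (e y).2 then M (e x).1 (e y).1 else 0
  map_one' := by
    ext x y
    simp only [Matrix.of_apply, Matrix.one_apply]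
    by_cases h : x = y
    · simp [h]
    · have : ¬ ((e x).2 = (e y).2 ∧ (e x).1 = (e y).1) := fun h' =>
        h (e.injective (Prod.ext h'.2 h'.1))
      rw [if_neg h, ← ite_and, if_neg this]
  map_mul' M N := by
    ext x y
    simp only [Matrix.of_apply, Matrix.mul_apply]
    rw [← e.symm.sum_comp, Fintype.sum_prod_type]
    simp only [Equiv.apply_symm_apply, ite_mul, zero_mul, mul_ite, mul_zero]
    simp
  map_zero' := by ext x y; simp
  map_add' M N := by
    ext x y
    simp only [Matrix.of_apply, Matrix.add_apply]
    split_ifs <;> simp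
  commutes' c := by
    ext x y
    simp only [Matrix.of_apply, Matrix.algebraMap_matrix_apply]
    by_cases h : x = y
    · simp [h]
    · have : ¬ ((e x).2 = (e y).2 ∧ (e x).1 = (e y).1) := fun h' =>
        h (e.injective (Prod.ext h'.2 h'.1))
      rw [if_neg h, ← ite_and, if_neg this]
  map_star' M := by
    ext x y
    simp only [Matrix.of_apply, Matrix.star_apply, eq_comm (a := (e x).2)]
    split_ifs <;> simp

lemma emb_apply {n m k : Type*} [Fintype n] [DecidableEq n] [Fintype m] [DecidableEq m] [Fintype k]
    [DecidableEq k] (e : n ≃ m × k) (M : Matrix m m ℂ) (x y : n) :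
    emb e M x y = if (e x).2 = (e y).2 then M (e x).1 (e y).1 else 0 := rfl

/-- partial trace along a factorization `n ≃ m × k` -/
def ptr {n m k : Type*} [Fintype k] (e : n ≃ m × k) (ρ : Matrix n n ℂ) : Matrix m m ℂ :=
  fun a b => ∑ c, ρ (e.symm (a, c)) (e.symm (b, c))

lemma ptr_dual {n m k : Type*} [Fintype n] [DecidableEq n] [Fintype m] [DecidableEq m] [Fintype k]
    [DecidableEq k] (e : n ≃ m × k) (ρ : Matrix n n ℂ) (X : Matrix m m ℂ) :
    (ρ * emb e X).trace = (ptr e ρ * X).trace := by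
  simp only [Matrix.trace, Matrix.diag_apply, Matrix.mul_apply, ptr, emb_apply]
  rw [← e.symm.sum_comp, Fintype.sum_prod_type]
  refine Finset.sum_congr rfl fun a _ => ?_
  have : ∀ c : k, (∑ j : n, ρ (e.symm (a, c)) j * if (e j).2 = (e (e.symm (a, c))).2 then
      X (e j).1 (e (e.symm (a, c))).1 else 0) = ∑ b, ρ (e.symm (a, c)) (e.symm (b, c)) * X b a := by
    intro c
    rw [← e.symm.sum_comp, Fintype.sum_prod_type]
    simp
  simp only [this, Finset.sum_mul]
  rw [Finset.sum_comm]

lemma ptr_eq_sum {n m k : Type*} [Fintype k] (e : n ≃ m × k) (ρ : Matrix n n ℂ) :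
    ptr e ρ = ∑ c, ρ.submatrix (fun a => e.symm (a, c)) (fun a => e.symm (a, c)) := by
  ext a b
  simp [ptr, Matrix.sum_apply]

lemma ptr_posSemidef {n m k : Type*} [Fintype k] (e : n ≃ m × k) {ρ : Matrix n n ℂ}
    (h : ρ.PosSemidef) : (ptr e ρ).PosSemidef := by
  rw [ptr_eq_sum]
  exact Matrix.posSemidef_sum _ fun c _ => h.submatrix _

lemma ptr_posDef {n m k : Type*} [Fintype k] [Nonempty k] (e : n ≃ m × k) {ρ : Matrix n n ℂ}
    (h : ρ.PosDef) : (ptr e ρ).PosDef := by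
  rw [ptr_eq_sum]
  refine Matrix.posDef_sum Finset.univ_nonempty fun c _ => h.submatrix ?_
  intro a b hab
  simpa using hab

lemma emb_posDef {n m k : Type*} [Fintype n] [DecidableEq n] [Fintype m] [DecidableEq m] [Fintype k]
    [DecidableEq k] (e : n ≃ m × k) {M : Matrix m m ℂ} (h : M.PosDef) : (emb e M).PosDef := by
  have hs : (emb e M).PosSemidef := by
    set U := (h.isHermitian.eigenvectorUnitary : Matrix m m ℂ)
    set S : Matrix m m ℂ := Matrix.diagonal (fun i => (Real.sqrt (h.isHermitian.eigenvalues i) : ℂ)) * Uᴴ with hS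
    have : M = star S * S := by
      conv_lhs => rw [spec_eq h.isHermitian]
      rw [hS, Matrix.star_eq_conjTranspose, Matrix.conjTranspose_mul, Matrix.conjTranspose_conjTranspose,
        Matrix.diagonal_conjTranspose, ← Matrix.mul_assoc,
        Matrix.mul_assoc U (Matrix.diagonal (star _)) (Matrix.diagonal _), Matrix.diagonal_mul_diagonal]
      congr 3
      ext i
      simp only [Pi.star_apply, RCLike.star_def, Complex.conj_ofReal]
      rw [← Complex.ofReal_mul, Real.mul_self_sqrt (h.eigenvalues_pos i).le]
    rw [this, map_mul, map_star]
    exact Matrix.posSemidef_conjTranspose_mul_self _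
  exact hs.posDef_iff_isUnit.2 (h.isUnit.map (emb e))

lemma matLog_emb {n m k : Type*} [Fintype n] [DecidableEq n] [Fintype m] [DecidableEq m] [Fintype k]
    [DecidableEq k] (e : n ≃ m × k) {M : Matrix m m ℂ} (h : M.PosDef) :
    matLog (emb e M) = emb e (matLog M) := by
  unfold matLog
  rw [matFun_eq_cfc h.isHermitian, matFun_eq_cfc (emb_posDef e h).isHermitian]
  refine (StarAlgHom.map_cfc (R := ℝ) (S := ℂ) (emb e) Real.log M
    (Set.Finite.continuousOn Matrix.finite_real_spectrum _) ?_ h.isHermitian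
    (emb_posDef e h).isHermitian).symm
  exact LinearMap.continuous_of_finiteDimensional (emb e).toLinearMap

lemma relEnt_emb {n m k : Type*} [Fintype n] [DecidableEq n] [Fintype m] [DecidableEq m] [Fintype k]
    [DecidableEq k] (e : n ≃ m × k) {ρ : Matrix n n ℂ} {M : Matrix m m ℂ} (h : M.PosDef) :
    relEnt ρ (emb e M) = -vnEnt ρ - (ptr e ρ * matLog M).trace.re := by
  unfold relEnt vnEnt
  rw [matLog_emb e h, Matrix.mul_sub, Matrix.trace_sub, ptr_dual]
  simp

lemma matLog_add {n : Type*} [Fintype n] [DecidableEq n] {ρ : Matrix n n ℂ} (hρ : ρ.IsHermitian)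
    (ε : ℝ) : matLog (ρ + algebraMap ℝ _ ε) = matFun (fun x => Real.log (x + ε)) ρ := by
  have h' : (ρ + algebraMap ℝ _ ε).IsHermitian := by
    refine hρ.add ?_
    exact IsSelfAdjoint.algebraMap _ (IsSelfAdjoint.all ε)
  unfold matLog
  rw [matFun_eq_cfc h', matFun_eq_cfc hρ]
  have e1 := cfc_add_const ε (fun x : ℝ => x) ρ (Set.Finite.continuousOn Matrix.finite_real_spectrum _) hρ
  have e2 : cfc (fun x : ℝ => x) ρ = ρ := cfc_id' ℝ ρ hρ
  rw [e2] at e1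
  rw [← e1]
  exact (cfc_comp Real.log (fun x => x + ε) ρ hρ
    (Set.Finite.continuousOn (Set.Finite.image _ Matrix.finite_real_spectrum) _)
    (Set.Finite.continuousOn Matrix.finite_real_spectrum _)).symm

lemma add_posDef {n : Type*} [Fintype n] [DecidableEq n] {ρ : Matrix n n ℂ} (hρ : ρ.PosSemidef)
    {ε : ℝ} (hε : 0 < ε) : (ρ + algebraMap ℝ _ ε).PosDef := by
  rw [add_comm]
  refine Matrix.PosDef.add_posSemidef ?_ hρ
  rw [Algebra.algebraMap_eq_smul_one]
  exact Matrix.PosDef.one.smul hε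

lemma tendsto_ent {n : Type*} [Fintype n] [DecidableEq n] {ρ : Matrix n n ℂ} (hρ : ρ.PosSemidef)
    (d : ℝ) : Filter.Tendsto (fun ε : ℝ => (ρ * matLog (ρ + algebraMap ℝ _ (d * ε))).trace.re)
      (nhdsWithin 0 (Set.Ioi 0)) (nhds (-vnEnt ρ)) := by
  unfold vnEnt
  simp only [matLog_add hρ.isHermitian, trace_mul_matFun_self hρ.isHermitian, Complex.ofReal_re, neg_neg]
  rw [matLog, trace_mul_matFun_self hρ.isHermitian, Complex.ofReal_re]
  refine tendsto_finsetSum _ fun i _ => ?_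
  have hr := hρ.eigenvalues_nonneg i
  set r := hρ.isHermitian.eigenvalues i
  rcases hr.eq_or_lt with h0 | h0
  · simp [← h0]
  · refine Filter.Tendsto.const_mul _ (Filter.Tendsto.log ?_ h0.ne')
    refine tendsto_nhdsWithin_of_tendsto_nhds ?_
    have : Continuous fun ε : ℝ => r + d * ε := by fun_prop
    simpa using this.tendsto 0

lemma holder {n : Type*} [Fintype n] [DecidableEq n] {ρ : Matrix n n ℂ} (hρ : IsState ρ)
    (M : Matrix n n ℂ) : (ρ * M).trace.re ≤ opNorm M := by
  have hh := hρ.1.isHermitian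
  set U := (hh.eigenvectorUnitary : Matrix n n ℂ) with hU
  have e1 : (ρ * M).trace = ∑ j, (hh.eigenvalues j : ℂ) * (Uᴴ * M * U) j j := by
    conv_lhs => rw [spec_eq hh]
    rw [Matrix.mul_assoc, Matrix.mul_assoc, Matrix.trace_mul_comm, Matrix.mul_assoc, ← hU]
    simp only [Matrix.trace, Matrix.diag_apply, Matrix.diagonal_mul]
  have hj : ∀ j, ((Uᴴ * M * U) j j).re ≤ opNorm M := by
    intro j
    have e2 : (Uᴴ * M * U) j j = inner ℂ (hh.eigenvectorBasis j)
        (LinearMap.toContinuousLinearMap (Matrix.toEuclideanLin M) (hh.eigenvectorBasis j)) := by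
      simp only [PiLp.inner_apply, Matrix.mul_assoc, Matrix.mul_apply (M := Uᴴ),
        Matrix.conjTranspose_apply, hU, Matrix.IsHermitian.eigenvectorUnitary_apply]
      refine Finset.sum_congr rfl fun i _ => ?_
      rw [RCLike.inner_apply, mul_comm]
      congr 1
    rw [e2]
    refine (Complex.re_le_norm _).trans ((norm_inner_le_norm _ _).trans ?_)
    have hn : ‖hh.eigenvectorBasis j‖ = 1 := hh.eigenvectorBasis.orthonormal.1 j
    have := (LinearMap.toContinuousLinearMap (Matrix.toEuclideanLin M)).le_opNorm (hh.eigenvectorBasis j)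
    rw [hn, one_mul]
    rw [hn, mul_one] at this
    exact this
  have hs : ∑ j, hh.eigenvalues j = 1 := by
    have := hρ.2
    rw [hh.trace_eq_sum_eigenvalues] at this
    have h2 := congrArg Complex.re this
    simpa using h2
  rw [e1, Complex.re_sum]
  calc _ ≤ ∑ j, hh.eigenvalues j * opNorm M := by
        refine Finset.sum_le_sum fun j _ => ?_
        rw [Complex.re_ofReal_mul]
        exact mul_le_mul_of_nonneg_left (hj j) (hρ.1.eigenvalues_nonneg j)
    _ = _ := by rw [← Finset.sum_mul, hs, one_mul]

section four
set_option linter.unusedSectionVars false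
variable {A B C D : Type*} [Fintype A] [Fintype B] [Fintype C] [Fintype D]
  [DecidableEq A] [DecidableEq B] [DecidableEq C] [DecidableEq D]

/-- tracing out `B` -/
def eB (A B C D : Type*) : A × B × C × D ≃ (A × C × D) × B where
  toFun x := ((x.1, x.2.2.1, x.2.2.2), x.2.1)
  invFun y := (y.1.1, y.2, y.1.2.1, y.1.2.2)
  left_inv _ := rfl
  right_inv _ := rfl

/-- tracing `ACD` to `AD` -/
def eAD (A C D : Type*) : A × C × D ≃ (A × D) × C where
  toFun x := ((x.1, x.2.2), x.2.1)
  invFun y := (y.1.1, y.2, y.1.2)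
  left_inv _ := rfl
  right_inv _ := rfl

/-- tracing `ACD` to `D` -/
def eD (A C D : Type*) : A × C × D ≃ D × (A × C) where
  toFun x := (x.2.2, (x.1, x.2.1))
  invFun y := (y.2.1, y.2.2, y.1)
  left_inv _ := rfl
  right_inv _ := rfl

lemma margACD_eq (ρ : Matrix (A × B × C × D) (A × B × C × D) ℂ) :
    margACD ρ = ptr (eB A B C D) ρ := rfl

lemma margAD_eq (ρ : Matrix (A × B × C × D) (A × B × C × D) ℂ) :
    margAD ρ = ptr (eAD A C D) (margACD ρ) := by
  ext x y
  exact Finset.sum_comm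

lemma margCD_eq (ρ : Matrix (A × B × C × D) (A × B × C × D) ℂ) :
    margCD ρ = ptr (Equiv.prodComm A (C × D)) (margACD ρ) := rfl

lemma margD_eq (ρ : Matrix (A × B × C × D) (A × B × C × D) ℂ) :
    margD ρ = ptr (eD A C D) (margACD ρ) := by
  ext x y
  unfold margD ptr
  rw [Fintype.sum_prod_type]
  exact Finset.sum_congr rfl fun a _ => Finset.sum_comm

lemma embAD_eq (M : Matrix (A × D) (A × D) ℂ) :
    (embAD M : Matrix (A × C × D) (A × C × D) ℂ) = emb (eAD A C D) M := rfl

lemma embCD_eq (M : Matrix (C × D) (C × D) ℂ) :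
    (embCD M : Matrix (A × C × D) (A × C × D) ℂ) = emb (Equiv.prodComm A (C × D)) M := rfl

lemma embD_eq (M : Matrix D D ℂ) :
    (embD M : Matrix (A × C × D) (A × C × D) ℂ) = emb (eD A C D) M := by
  ext x y
  rw [emb_apply]
  unfold embD eD
  simp [Prod.ext_iff]

/-- strong subadditivity -/
lemma ssa [Nonempty C] {τ : Matrix (A × C × D) (A × C × D) ℂ} (hτ : τ.PosSemidef) :
    vnEnt τ + vnEnt (ptr (eD A C D) τ) ≤
      vnEnt (ptr (Equiv.prodComm A (C × D)) τ) + vnEnt (ptr (eAD A C D) τ) := by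
  set τAD := ptr (eAD A C D) τ with hAD
  set τCD := ptr (Equiv.prodComm A (C × D)) τ with hCD
  set τD := ptr (eD A C D) τ with hD
  have pAD : τAD.PosSemidef := ptr_posSemidef _ hτ
  have pCD : τCD.PosSemidef := ptr_posSemidef _ hτ
  have pD : τD.PosSemidef := ptr_posSemidef _ hτ
  have q1 : ptr (Equiv.prodComm C D) τCD = τD := by
    ext x y
    simp only [hD, hCD, ptr]
    rw [Fintype.sum_prod_type]
    exact Finset.sum_comm
  have q2 : ptr (Equiv.prodComm A D) τAD = τD := by
    ext x y
    simp only [hD, hAD, ptr]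
    rw [Fintype.sum_prod_type]
    rfl
  have key : ∀ ε : ℝ, 0 < ε →
      -vnEnt τAD - (τD * matLog (τD + algebraMap ℝ _ (Fintype.card C * ε))).trace.re ≤
      -vnEnt τ - (τCD * matLog (τCD + algebraMap ℝ _ (1 * ε))).trace.re := by
    intro ε hε
    have hc : (0 : ℝ) < Fintype.card C * ε := by
      have : 0 < Fintype.card C := Fintype.card_pos
      positivity
    have p1 := add_posDef pCD (show 0 < 1 * ε by simpa using hε)
    have p2 := add_posDef pD hc
    have h := dpi (emb (eAD A C D)) hτ (emb_posDef (Equiv.prodComm A (C × D)) p1) pAD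
      (emb_posDef (Equiv.prodComm A D) p2) (fun X => ptr_dual _ _ _) (fun X => by
        rw [ptr_dual]
        congr 2
        ext x y
        simp only [ptr, emb_apply]
        by_cases hxy : x.1 = y.1
        · rw [← q1]
          simp [eAD, hxy, ptr, Finset.sum_add_distrib, Matrix.algebraMap_matrix_apply, -map_mul, -map_natCast]
        · simp [eAD, hxy])
    rw [relEnt_emb _ p1, relEnt_emb _ p2, q2] at h
    exact h
  have := le_of_tendsto_of_tendsto ((tendsto_ent pD (Fintype.card C)).const_sub (-vnEnt τAD))
    ((tendsto_ent pCD 1).const_sub (-vnEnt τ))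
    (by filter_upwards [self_mem_nhdsWithin] with ε hε using key ε hε)
  linarith

end four

/-- **Weak entropy factorization.**
`D_{ABC}(ρ‖σ) ≤ D_{AB}(ρ‖σ) + D_{BC}(ρ‖σ) + ‖log σ_{ACD} + log σ_D − log σ_{AD} − log σ_{CD}‖_∞`,
where the complements of `ABC`, `AB`, `BC` are `D`, `CD`, `AD` respectively. -/
theorem stmt1 {ιA ιB ιC ιD : Type*} [Fintype ιA] [Fintype ιB] [Fintype ιC] [Fintype ιD]
    [DecidableEq ιA] [DecidableEq ιB] [DecidableEq ιC] [DecidableEq ιD]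
    (ρ σ : Matrix (ιA × ιB × ιC × ιD) (ιA × ιB × ιC × ιD) ℂ)
    (hρ : IsState ρ) (hσ : IsState σ) (hσpos : σ.PosDef) :
    condRelEnt ρ σ margD ≤ condRelEnt ρ σ margCD + condRelEnt ρ σ margAD + opNorm (mcmi σ) := by
  have hne : Nonempty (ιA × ιB × ιC × ιD) := by
    by_contra h
    rw [not_nonempty_iff] at h
    have := hρ.2
    simp [Matrix.trace] at this
  obtain ⟨_, b, c, _⟩ := hne
  haveI : Nonempty ιB := ⟨b⟩
  haveI : Nonempty ιC := ⟨c⟩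
  have pρ : (margACD ρ).PosSemidef := ptr_posSemidef (eB ιA ιB ιC ιD) hρ.1
  have pσ : (margACD σ).PosDef := ptr_posDef (eB ιA ιB ιC ιD) hσpos
  have hdpi : relEnt (margACD ρ) (margACD σ) ≤ relEnt ρ σ :=
    dpi (emb (eB ιA ιB ιC ιD)) hρ.1 hσpos pρ pσ (fun X => ptr_dual _ _ _) (fun X => ptr_dual _ _ _)
  have hst : IsState (margACD ρ) := by
    refine ⟨pρ, ?_⟩
    have := ptr_dual (eB ιA ιB ιC ιD) ρ 1
    rw [map_one, Matrix.mul_one, Matrix.mul_one, hρ.2] at this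
    exact this.symm
  have hssa := ssa pρ
  have hH := holder hst (mcmi σ)
  unfold mcmi at hH
  unfold condRelEnt
  rw [embAD_eq, embCD_eq, embD_eq, Matrix.mul_sub, Matrix.mul_sub, Matrix.mul_add, Matrix.trace_sub,
    Matrix.trace_sub, Matrix.trace_add, ptr_dual, ptr_dual, ptr_dual, ← margAD_eq, ← margCD_eq,
    ← margD_eq] at hH
  rw [← margAD_eq, ← margCD_eq, ← margD_eq] at hssa
  unfold mcmi
  rw [embAD_eq, embCD_eq, embD_eq]
  simp only [Complex.sub_re, Complex.add_re] at hH
  have r1 : relEnt (margACD ρ) (margACD σ) = -vnEnt (margACD ρ) - (margACD ρ * matLog (margACD σ)).trace.re := by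
    simp [relEnt, vnEnt, Matrix.mul_sub]
  have r2 : relEnt (margAD ρ) (margAD σ) = -vnEnt (margAD ρ) - (margAD ρ * matLog (margAD σ)).trace.re := by
    simp [relEnt, vnEnt, Matrix.mul_sub]
  have r3 : relEnt (margCD ρ) (margCD σ) = -vnEnt (margCD ρ) - (margCD ρ * matLog (margCD σ)).trace.re := by
    simp [relEnt, vnEnt, Matrix.mul_sub]
  have r4 : relEnt (margD ρ) (margD σ) = -vnEnt (margD ρ) - (margD ρ * matLog (margD σ)).trace.re := by
    simp [relEnt, vnEnt, Matrix.mul_sub]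
  linarith

end Paper
end
end

section
/- Classical strong entropy factorization: if ρ, σ are commuting (i.e. classical/diagonal in a common product basis) states on H_A ⊗ H_B ⊗ H_C ⊗ H_D with σ full rank, then (1 − ‖exp(H_σ(A:C|D)) − Id‖_∞) · D_{ABC}(ρ‖σ) ≤ D_{AB}(ρ‖σ) + D_{BC}(ρ‖σ), where H_σ(A:C|D) := log σ_{ACD} + log σ_D − log σ_{AD} − log σ_{CD}. -/
open scoped BigOperators

noncomputable section

namespace Paper

variable {ιA ιB ιC ιD : Type*} [Fintype ιA] [Fintype ιB] [Fintype ιC] [Fintype ιD]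

/-- Kullback–Leibler divergence of two probability mass functions on a finite type. -/
def kl {α : Type*} [Fintype α] (p q : α → ℝ) : ℝ :=
  ∑ x, p x * Real.log (p x / q x)

/-- Marginal of a distribution on `A × B × C × D` on the factor `ACD`. -/
def pACD (p : ιA × ιB × ιC × ιD → ℝ) : ιA × ιC × ιD → ℝ :=
  fun x => ∑ b : ιB, p (x.1, b, x.2.1, x.2.2)

/-- Marginal on `AD`. -/
def pAD (p : ιA × ιB × ιC × ιD → ℝ) : ιA × ιD → ℝ :=
  fun x => ∑ b : ιB, ∑ c : ιC, p (x.1, b, c, x.2)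

/-- Marginal on `CD`. -/
def pCD (p : ιA × ιB × ιC × ιD → ℝ) : ιC × ιD → ℝ :=
  fun x => ∑ a : ιA, ∑ b : ιB, p (a, b, x.1, x.2)

/-- Marginal on `D`. -/
def pD (p : ιA × ιB × ιC × ιD → ℝ) : ιD → ℝ :=
  fun x => ∑ a : ιA, ∑ b : ιB, ∑ c : ιC, p (a, b, c, x)

/-- The (classical, function-valued) conditional mutual information kernel
`H_q(A:C|D) = log q_{ACD} + log q_D − log q_{AD} − log q_{CD}`. -/
def mcmiCl (q : ιA × ιB × ιC × ιD → ℝ) : ιA × ιC × ιD → ℝ :=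
  fun x => Real.log (pACD q x) + Real.log (pD q x.2.2)
    - Real.log (pAD q (x.1, x.2.2)) - Real.log (pCD q x.2)

/-- Pointwise Pinsker-type inequality for powers. -/
lemma pointwise_pinsker {p x : ℝ} (hp1 : 1 ≤ p) (hp2 : p ≤ 2) (hx : 0 ≤ x) :
    3 / 2 * p * (p - 1) * (x - 1) ^ 2
      ≤ (x ^ p - 1 - p * (x - 1)) * (3 + (2 - p) * (x - 1)) := by
  set G : ℝ → ℝ := fun x => (x ^ p - 1 - p * (x - 1)) * (3 + (2 - p) * (x - 1))
    - 3 / 2 * p * (p - 1) * (x - 1) ^ 2 with hG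
  set G' : ℝ → ℝ := fun x => (p * x ^ (p - 1) - p) * (3 + (2 - p) * (x - 1))
    + (x ^ p - 1 - p * (x - 1)) * (2 - p) - 3 * p * (p - 1) * (x - 1) with hG'
  set G'' : ℝ → ℝ := fun x => (p * ((p - 1) * x ^ (p - 1 - 1))) * (3 + (2 - p) * (x - 1))
    + (p * x ^ (p - 1) - p) * (2 - p)
    + (p * x ^ (p - 1) - p) * (2 - p) - 3 * p * (p - 1) with hG''
  have hpow : ∀ (r y : ℝ), 0 < y → HasDerivAt (fun z : ℝ => z ^ r) (r * y ^ (r - 1)) y :=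
    fun r y hy => Real.hasDerivAt_rpow_const (Or.inl hy.ne')
  have hlin : ∀ y : ℝ, HasDerivAt (fun z : ℝ => z - 1) 1 y :=
    fun y => (hasDerivAt_id y).sub_const 1
  have hd1 : ∀ y, 0 < y → HasDerivAt G (G' y) y := by
    intro y hy
    have h := ((((hpow p y hy).sub_const 1).sub ((hlin y).const_mul p)).mul
      (((hlin y).const_mul (2 - p)).const_add 3)).sub
      (((hlin y).pow 2).const_mul (3 / 2 * p * (p - 1)))
    refine (h.congr_deriv ?_)
    simp only [hG', Pi.sub_apply]
    push_cast
    ring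
  have hd2 : ∀ y, 0 < y → HasDerivAt G' (G'' y) y := by
    intro y hy
    have h := (((((hpow (p - 1) y hy).const_mul p).sub_const p).mul
      (((hlin y).const_mul (2 - p)).const_add 3)).add
      ((((hpow p y hy).sub_const 1).sub ((hlin y).const_mul p)).mul_const (2 - p))).sub
      ((hlin y).const_mul (3 * p * (p - 1)))
    refine (h.congr_deriv ?_)
    simp only [hG'']
    ring
  have hint : interior (Set.Ici (0 : ℝ)) = Set.Ioi 0 := interior_Ici
  have hconv : ConvexOn ℝ (Set.Ici 0) G := by
    refine convexOn_of_hasDerivWithinAt2_nonneg (f' := G') (f'' := G'') (convex_Ici 0) ?_ ?_ ?_ ?_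
    · have : Continuous fun z : ℝ => z ^ p := Real.continuous_rpow_const (by linarith)
      apply Continuous.continuousOn
      simp only [hG]
      fun_prop
    · intro y hy
      rw [hint] at hy
      exact (hd1 y hy).hasDerivWithinAt
    · intro y hy
      rw [hint] at hy
      exact (hd2 y hy).hasDerivWithinAt
    · intro y hy
      rw [hint] at hy
      have hy : 0 < y := hy
      have hmul : y ^ (p - 1 - 1) * y = y ^ (p - 1) := by
        rw [Real.rpow_sub_one hy.ne' (p - 1)]
        field_simp
      have hag := Real.geom_mean_le_arith_mean2_weighted (w₁ := p - 1) (w₂ := 2 - p)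
        (p₁ := y ^ (p - 1 - 1)) (p₂ := y ^ (p - 1)) (by linarith) (by linarith)
        (by positivity) (by positivity) (by ring)
      rw [← Real.rpow_mul hy.le, ← Real.rpow_mul hy.le, ← Real.rpow_add hy] at hag
      have he : (p - 1 - 1) * (p - 1) + (p - 1) * (2 - p) = 0 := by ring
      rw [he, Real.rpow_zero] at hag
      have : G'' y = p * (p + 1) * ((p - 1) * y ^ (p - 1 - 1) + (2 - p) * y ^ (p - 1) - 1) := by
        simp only [hG'']
        rw [← hmul]
        ring
      rw [this]
      have h0 : 0 ≤ p * (p + 1) := by nlinarith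
      exact mul_nonneg h0 (by linarith)
  have hmin : IsMinOn G (Set.Ici 0) 1 := by
    apply hconv.isMinOn_of_rightDeriv_eq_zero
    · rw [hint]; exact (one_pos : (0 : ℝ) < 1)
    · have h := (hd1 1 one_pos).hasDerivWithinAt (s := Set.Ioi 1)
      rw [h.derivWithin (uniqueDiffWithinAt_Ioi 1)]
      simp [hG']
  have h := hmin (show x ∈ Set.Ici 0 from hx)
  have h1 : G 1 = 0 := by simp [hG]
  have h2 : G 1 ≤ G x := h
  rw [h1] at h2
  simp only [hG] at h2
  linarith

/-- Two-uniform-convexity type inequality. -/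
lemma single_var {α : Type*} [Fintype α] (μ F : α → ℝ) {s : ℝ} (hs0 : 0 ≤ s) (hs1 : s ≤ 1)
    (hμ : ∀ a, 0 < μ a) (hμ1 : ∑ a, μ a = 1) (hF : ∀ a, 0 ≤ F a)
    (hFp : ∑ a, μ a * F a ^ (1 + s) = 1) :
    (∑ a, μ a * F a) ^ 2 + s * (∑ a, μ a * |F a - ∑ a, μ a * F a|) ^ 2 ≤ 1 := by
  set m := ∑ a, μ a * F a with hm
  have hm0 : 0 < m := by
    rcases (Finset.sum_nonneg (fun a _ => mul_nonneg (hμ a).le (hF a)) :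
      0 ≤ ∑ a, μ a * F a).lt_or_eq with h | h
    · exact h
    · exfalso
      have h2 := (Finset.sum_eq_zero_iff_of_nonneg
        (fun a _ => mul_nonneg (hμ a).le (hF a))).1 h.symm
      have : ∑ a, μ a * F a ^ (1 + s) = 0 := by
        apply Finset.sum_eq_zero
        intro a ha
        have := h2 a ha
        have h3 : F a = 0 := by
          rcases mul_eq_zero.1 this with h | h
          · exact absurd h (hμ a).ne'
          · exact h
        rw [h3, Real.zero_rpow (by linarith), mul_zero]
      linarith
  set f : α → ℝ := fun a => F a / m with hf
  have hf0 : ∀ a, 0 ≤ f a := fun a => div_nonneg (hF a) hm0.le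
  have hfm : ∑ a, μ a * f a = 1 := by
    simp only [hf, ← mul_div_assoc]
    rw [← Finset.sum_div, ← hm, div_self hm0.ne']
  set N := ∑ a, μ a * f a ^ (1 + s) with hN
  have hNm : N = (m ^ (1 + s))⁻¹ := by
    simp only [hN, hf]
    rw [Finset.sum_congr rfl (fun a _ => by
      rw [Real.div_rpow (hF a) hm0.le, ← mul_div_assoc])]
    rw [← Finset.sum_div, hFp, one_div]
  set V := ∑ a, μ a * |f a - 1| with hV
  have hVm : ∑ a, μ a * |F a - m| = m * V := by
    rw [hV, Finset.mul_sum]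
    refine Finset.sum_congr rfl fun a _ => ?_
    have : F a - m = m * (f a - 1) := by
      simp only [hf]; field_simp
    rw [this, abs_mul, abs_of_pos hm0]
    ring
  have hN1 : 0 < N := by rw [hNm]; positivity
  -- Pinsker
  have hP : (1 + s) * s / 2 * V ^ 2 ≤ N - 1 := by
    have key := Finset.sum_sq_le_sum_mul_sum_of_sq_le_mul (Finset.univ : Finset α)
      (r := fun a => √(3 / 2 * (1 + s) * s) * (μ a * |f a - 1|))
      (f := fun a => μ a * (f a ^ (1 + s) - 1 - (1 + s) * (f a - 1)))
      (g := fun a => μ a * (3 + (1 - s) * (f a - 1))) ?_ ?_ ?_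
    · rw [← Finset.mul_sum, ← hV, mul_pow, Real.sq_sqrt (by positivity)] at key
      have e1 : ∑ a, μ a * (f a ^ (1 + s) - 1 - (1 + s) * (f a - 1)) = N - 1 := by
        have : ∀ a, μ a * (f a ^ (1 + s) - 1 - (1 + s) * (f a - 1))
          = μ a * f a ^ (1 + s) - (1 + s) * (μ a * f a) + s * μ a := fun a => by ring
        simp only [this, Finset.sum_add_distrib, Finset.sum_sub_distrib, ← Finset.mul_sum]
        rw [hfm, hμ1, ← hN]; ring
      have e2 : ∑ a, μ a * (3 + (1 - s) * (f a - 1)) = 3 := by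
        have : ∀ a, μ a * (3 + (1 - s) * (f a - 1))
          = (1 - s) * (μ a * f a) + (2 + s) * μ a := fun a => by ring
        simp only [this, Finset.sum_add_distrib, ← Finset.mul_sum]
        rw [hfm, hμ1]; ring
      rw [e1, e2] at key
      linarith
    · intro a _
      have := one_add_mul_self_le_rpow_one_add (s := f a - 1) (by linarith [hf0 a])
        (p := 1 + s) (by linarith)
      rw [show 1 + (f a - 1) = f a by ring] at this
      exact mul_nonneg (hμ a).le (by linarith)
    · intro a _
      refine mul_nonneg (hμ a).le ?_
      nlinarith [mul_nonneg (sub_nonneg.2 hs1) (hf0 a)]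
    · intro a _
      have h := pointwise_pinsker (p := 1 + s) (x := f a) (by linarith) (by linarith) (hf0 a)
      rw [mul_pow, Real.sq_sqrt (by positivity), mul_pow, sq_abs]
      have h2 := mul_le_mul_of_nonneg_left h (sq_nonneg (μ a))
      rw [show (1 + s - 1) = s by ring, show 2 - (1 + s) = 1 - s by ring] at h2
      linarith
  -- Bernoulli
  have hB := one_add_mul_self_le_rpow_one_add (s := N - 1) (by linarith) (p := 2 / (1 + s))
    (by rw [le_div_iff₀ (by linarith)]; linarith)
  have hpw : (1 + (N - 1)) ^ (2 / (1 + s)) = (m ^ 2)⁻¹ := by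
    rw [show 1 + (N - 1) = N by ring, hNm, Real.inv_rpow (by positivity), ← Real.rpow_mul hm0.le,
      mul_div_cancel₀ _ (by linarith : (1 + s) ≠ 0), Real.rpow_two]
  rw [hpw] at hB
  have hB2 : 1 + s * V ^ 2 ≤ (m ^ 2)⁻¹ := by
    refine le_trans ?_ hB
    have := mul_le_mul_of_nonneg_left hP (by positivity : 0 ≤ 2 / (1 + s))
    have e : 2 / (1 + s) * ((1 + s) * s / 2 * V ^ 2) = s * V ^ 2 := by field_simp
    rw [e] at this
    linarith
  rw [hVm]
  have := mul_le_mul_of_nonneg_left hB2 (sq_nonneg m)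
  rw [mul_inv_cancel₀ (by positivity)] at this
  linarith

/-- Hypercontractive-type bound for weakly dependent pairs. -/
lemma two_var {α γ : Type*} [Fintype α] [Fintype γ] (μ F : α → ℝ) (ν H : γ → ℝ)
    (w : α → γ → ℝ) {s : ℝ} (hs0 : 0 ≤ s) (hs1 : s ≤ 1)
    (hμ : ∀ a, 0 < μ a) (hν : ∀ c, 0 < ν c)
    (hμ1 : ∑ a, μ a = 1) (hν1 : ∑ c, ν c = 1)
    (hwa : ∀ a, ∑ c, w a c = μ a) (hwc : ∀ c, ∑ a, w a c = ν c)
    (hw : ∀ a c, |w a c - μ a * ν c| ≤ s * (μ a * ν c))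
    (hF : ∀ a, 0 ≤ F a) (hH : ∀ c, 0 ≤ H c)
    (hFp : ∑ a, μ a * F a ^ (1 + s) = 1) (hHp : ∑ c, ν c * H c ^ (1 + s) = 1) :
    ∑ a, ∑ c, w a c * (F a * H c) ≤ 1 := by
  have h1 := single_var μ F hs0 hs1 hμ hμ1 hF hFp
  have h2 := single_var ν H hs0 hs1 hν hν1 hH hHp
  set m := ∑ a, μ a * F a with hm
  set n := ∑ c, ν c * H c with hn
  set x := ∑ a, μ a * |F a - m| with hx
  set y := ∑ c, ν c * |H c - n| with hy
  have e1 : ∑ a, ∑ c, w a c * F a = m := by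
    simp only [← Finset.sum_mul, hwa, hm]
  have e2 : ∑ a, ∑ c, w a c * H c = n := by
    rw [Finset.sum_comm]
    simp only [← Finset.sum_mul, hwc, hn]
  have e3 : ∑ a, ∑ c, w a c = 1 := by simp only [hwa, hμ1]
  have e4 : ∑ a, ∑ c, w a c * ((F a - m) * (H c - n))
      = ∑ a, ∑ c, w a c * (F a * H c) - m * n := by
    have : ∀ a c, w a c * ((F a - m) * (H c - n))
      = w a c * (F a * H c) - n * (w a c * F a) - m * (w a c * H c) + m * n * w a c :=
      fun a c => by ring
    simp only [this, Finset.sum_add_distrib, Finset.sum_sub_distrib, ← Finset.mul_sum, e1, e2, e3]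
    ring
  have z1 : ∑ a, μ a * (F a - m) = 0 := by
    simp only [mul_sub, Finset.sum_sub_distrib, ← Finset.sum_mul, hμ1, ← hm]; ring
  have e5 : ∑ a, ∑ c, (μ a * ν c) * ((F a - m) * (H c - n)) = 0 := by
    have : ∀ a c, (μ a * ν c) * ((F a - m) * (H c - n))
      = (μ a * (F a - m)) * (ν c * (H c - n)) := fun a c => by ring
    simp only [this, ← Finset.mul_sum, ← Finset.sum_mul, z1, zero_mul]
  have e6 : ∑ a, ∑ c, s * ((μ a * |F a - m|) * (ν c * |H c - n|)) = s * (x * y) := by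
    simp only [← Finset.mul_sum, ← Finset.sum_mul, hx, hy]
  have e7 : ∑ a, ∑ c, w a c * ((F a - m) * (H c - n)) -
      ∑ a, ∑ c, (μ a * ν c) * ((F a - m) * (H c - n)) ≤ s * (x * y) := by
    rw [← e6, ← Finset.sum_sub_distrib]
    refine Finset.sum_le_sum fun a _ => ?_
    rw [← Finset.sum_sub_distrib]
    refine Finset.sum_le_sum fun c _ => ?_
    rw [← sub_mul]
    refine (le_abs_self _).trans ?_
    rw [abs_mul, abs_mul]
    have := mul_le_mul_of_nonneg_right (hw a c)
      (mul_nonneg (abs_nonneg (F a - m)) (abs_nonneg (H c - n)))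
    linarith
  rw [e4, e5] at e7
  nlinarith [sq_nonneg (m - n), mul_nonneg hs0 (sq_nonneg (x - y))]

/-- Gibbs inequality. -/
lemma gibbs {α : Type*} [Fintype α] (P R : α → ℝ) (hP : ∀ x, 0 ≤ P x) (hR0 : ∀ x, 0 ≤ R x)
    (hR : ∀ x, 0 < P x → 0 < R x) (hs : ∑ x, R x ≤ ∑ x, P x) :
    0 ≤ ∑ x, P x * (Real.log (P x) - Real.log (R x)) := by
  have : ∑ x, (P x - R x) ≤ ∑ x, P x * (Real.log (P x) - Real.log (R x)) := by
    refine Finset.sum_le_sum fun x _ => ?_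
    rcases (hP x).lt_or_eq with h | h
    · have hr := hR x h
      have := Real.log_le_sub_one_of_pos (div_pos hr h)
      rw [Real.log_div hr.ne' h.ne'] at this
      have h2 := mul_le_mul_of_nonneg_left this h.le
      have e : P x * (R x / P x - 1) = R x - P x := by field_simp
      rw [e] at h2
      linarith
    · rw [← h]; simpa using hR0 x
  rw [Finset.sum_sub_distrib] at this
  linarith

lemma dv {α : Type*} [Fintype α] (p q W : α → ℝ) (hp0 : ∀ x, 0 ≤ p x) (hp1 : ∑ x, p x = 1)
    (hq0 : ∀ x, 0 < q x) (hW0 : ∀ x, 0 ≤ W x) (hW : ∀ x, 0 < p x → 0 < W x)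
    (hs : ∑ x, q x * W x ≤ 1) :
    ∑ x, p x * Real.log (W x) ≤ kl p q := by
  have h := gibbs p (fun x => q x * W x) hp0 (fun x => mul_nonneg (hq0 x).le (hW0 x))
    (fun x hx => mul_pos (hq0 x) (hW x hx)) (by rw [hp1]; exact hs)
  rw [← sub_nonneg, kl, ← Finset.sum_sub_distrib]
  refine h.trans_eq (Finset.sum_congr rfl fun x _ => ?_)
  rcases (hp0 x).lt_or_eq with h | h
  · rw [Real.log_div h.ne' (hq0 x).ne', Real.log_mul (hq0 x).ne' (hW x h).ne']
    ring
  · rw [← h]; simp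

section marg

lemma sum_pD (p : ιA × ιB × ιC × ιD → ℝ) (h : ιD → ℝ) :
    ∑ d, pD p d * h d = ∑ x, p x * h x.2.2.2 := by
  simp only [pD, Fintype.sum_prod_type, Finset.sum_mul]
  rw [Finset.sum_comm]
  refine Finset.sum_congr rfl fun a _ => ?_
  rw [Finset.sum_comm]
  refine Finset.sum_congr rfl fun b _ => ?_
  rw [Finset.sum_comm]

lemma sum_pAD (p : ιA × ιB × ιC × ιD → ℝ) (h : ιA × ιD → ℝ) :
    ∑ y, pAD p y * h y = ∑ x, p x * h (x.1, x.2.2.2) := by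
  simp only [pAD, Fintype.sum_prod_type, Finset.sum_mul]
  refine Finset.sum_congr rfl fun a _ => ?_
  rw [Finset.sum_comm]
  refine Finset.sum_congr rfl fun b _ => ?_
  rw [Finset.sum_comm]

lemma sum_pCD (p : ιA × ιB × ιC × ιD → ℝ) (h : ιC × ιD → ℝ) :
    ∑ y, pCD p y * h y = ∑ x, p x * h x.2.2 := by
  have : ∑ y, pCD p y * h y = ∑ y, ∑ a, ∑ b, p (a, b, y) * h y := by
    simp only [pCD, Finset.sum_mul]
  rw [this, Finset.sum_comm, Fintype.sum_prod_type]
  refine Finset.sum_congr rfl fun a _ => ?_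
  rw [Finset.sum_comm, Fintype.sum_prod_type]

lemma sum_pACD (p : ιA × ιB × ιC × ιD → ℝ) (h : ιA → ιC → ιD → ℝ) :
    ∑ d, ∑ a, ∑ c, pACD p (a, c, d) * h a c d = ∑ x, p x * h x.1 x.2.2.1 x.2.2.2 := by
  simp only [pACD, Fintype.sum_prod_type, Finset.sum_mul]
  rw [Finset.sum_comm]
  refine Finset.sum_congr rfl fun a _ => ?_
  have : ∀ d, ∑ c, ∑ b, p (a, b, c, d) * h a c d = ∑ b, ∑ c, p (a, b, c, d) * h a c d :=
    fun d => Finset.sum_comm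
  simp only [this]
  rw [Finset.sum_comm]
  refine Finset.sum_congr rfl fun b _ => ?_
  rw [Finset.sum_comm]

lemma marg_ACD_AD (p : ιA × ιB × ιC × ιD → ℝ) (a : ιA) (d : ιD) :
    ∑ c, pACD p (a, c, d) = pAD p (a, d) := by
  simp only [pACD, pAD]; rw [Finset.sum_comm]

lemma marg_ACD_CD (p : ιA × ιB × ιC × ιD → ℝ) (c : ιC) (d : ιD) :
    ∑ a, pACD p (a, c, d) = pCD p (c, d) := by
  simp only [pACD, pCD]

lemma marg_AD_D (p : ιA × ιB × ιC × ιD → ℝ) (d : ιD) :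
    ∑ a, pAD p (a, d) = pD p d := by
  simp only [pAD, pD]

lemma marg_CD_D (p : ιA × ιB × ιC × ιD → ℝ) (d : ιD) :
    ∑ c, pCD p (c, d) = pD p d := by
  simp only [pCD, pD]
  rw [Finset.sum_comm]
  refine Finset.sum_congr rfl fun a _ => ?_
  rw [Finset.sum_comm]

end marg

/-- **Classical strong entropy factorization.** For probability distributions `p, q` on a
four-fold product (i.e. commuting states diagonal in a common product basis) with `q`
of full support,
`(1 − ‖exp(H_q(A:C|D)) − 1‖_∞) · D_{ABC}(p‖q) ≤ D_{AB}(p‖q) + D_{BC}(p‖q)`,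
where `D_R(p‖q) = D(p‖q) − D(p_{R̄}‖q_{R̄})` are the conditional relative entropies. -/
theorem stmt2 (p q : ιA × ιB × ιC × ιD → ℝ)
    (hp0 : ∀ x, 0 ≤ p x) (hp1 : ∑ x, p x = 1)
    (hq0 : ∀ x, 0 < q x) (hq1 : ∑ x, q x = 1) :
    (1 - ⨆ x : ιA × ιC × ιD, |Real.exp (mcmiCl q x) - 1|) * (kl p q - kl (pD p) (pD q))
      ≤ (kl p q - kl (pCD p) (pCD q)) + (kl p q - kl (pAD p) (pAD q)) := by
  obtain ⟨⟨a₀, b₀, c₀, d₀⟩⟩ : Nonempty (ιA × ιB × ιC × ιD) := by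
    by_contra h
    rw [not_nonempty_iff] at h
    simp at hp1
  haveI : Nonempty ιA := ⟨a₀⟩
  haveI : Nonempty ιB := ⟨b₀⟩
  haveI : Nonempty ιC := ⟨c₀⟩
  -- positivity of the marginals of `q`
  have hqACD : ∀ y, 0 < pACD q y := fun y =>
    Finset.sum_pos (fun b _ => hq0 _) Finset.univ_nonempty
  have hqAD : ∀ y, 0 < pAD q y := fun y => Finset.sum_pos (fun b _ =>
    Finset.sum_pos (fun c _ => hq0 _) Finset.univ_nonempty) Finset.univ_nonempty
  have hqCD : ∀ y, 0 < pCD q y := fun y => Finset.sum_pos (fun b _ =>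
    Finset.sum_pos (fun c _ => hq0 _) Finset.univ_nonempty) Finset.univ_nonempty
  have hqD : ∀ y, 0 < pD q y := fun y => Finset.sum_pos (fun a _ => Finset.sum_pos (fun b _ =>
    Finset.sum_pos (fun c _ => hq0 _) Finset.univ_nonempty) Finset.univ_nonempty)
    Finset.univ_nonempty
  -- nonnegativity of the marginals of `p`
  have hpAD : ∀ y, 0 ≤ pAD p y := fun y => Finset.sum_nonneg fun b _ =>
    Finset.sum_nonneg fun c _ => hp0 _
  have hpCD : ∀ y, 0 ≤ pCD p y := fun y => Finset.sum_nonneg fun b _ =>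
    Finset.sum_nonneg fun c _ => hp0 _
  have hpD : ∀ y, 0 ≤ pD p y := fun y => Finset.sum_nonneg fun a _ => Finset.sum_nonneg fun b _ =>
    Finset.sum_nonneg fun c _ => hp0 _
  have hpAD' : ∀ x, 0 < p x → 0 < pAD p (x.1, x.2.2.2) := by
    intro x hx
    refine hx.trans_le ?_
    refine le_trans ?_ (Finset.single_le_sum (f := fun b => ∑ c, p (x.1, b, c, x.2.2.2))
      (fun b _ => Finset.sum_nonneg fun c _ => hp0 _) (Finset.mem_univ x.2.1))
    exact Finset.single_le_sum (f := fun c => p (x.1, x.2.1, c, x.2.2.2))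
      (fun c _ => hp0 _) (Finset.mem_univ x.2.2.1)
  have hpCD' : ∀ x, 0 < p x → 0 < pCD p x.2.2 := by
    intro x hx
    refine hx.trans_le ?_
    refine le_trans ?_ (Finset.single_le_sum (f := fun a => ∑ b, p (a, b, x.2.2.1, x.2.2.2))
      (fun b _ => Finset.sum_nonneg fun c _ => hp0 _) (Finset.mem_univ x.1))
    exact Finset.single_le_sum (f := fun b => p (x.1, b, x.2.2.1, x.2.2.2))
      (fun c _ => hp0 _) (Finset.mem_univ x.2.1)
  have hpD' : ∀ x, 0 < p x → 0 < pD p x.2.2.2 := by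
    intro x hx
    refine (hpAD' x hx).trans_le ?_
    rw [← marg_AD_D]
    exact Finset.single_le_sum (f := fun a => pAD p (a, x.2.2.2))
      (fun a _ => hpAD _) (Finset.mem_univ x.1)
  set rA : ιA × ιD → ℝ := fun y => pAD p y / pAD q y with hrA
  set rC : ιC × ιD → ℝ := fun y => pCD p y / pCD q y with hrC
  set rD : ιD → ℝ := fun y => pD p y / pD q y with hrD
  have rA0 : ∀ y, 0 ≤ rA y := fun y => div_nonneg (hpAD y) (hqAD y).le
  have rC0 : ∀ y, 0 ≤ rC y := fun y => div_nonneg (hpCD y) (hqCD y).le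
  have rD0 : ∀ y, 0 ≤ rD y := fun y => div_nonneg (hpD y) (hqD y).le
  have rA1 : ∀ x, 0 < p x → 0 < rA (x.1, x.2.2.2) := fun x hx => div_pos (hpAD' x hx) (hqAD _)
  have rC1 : ∀ x, 0 < p x → 0 < rC x.2.2 := fun x hx => div_pos (hpCD' x hx) (hqCD _)
  have rD1 : ∀ x, 0 < p x → 0 < rD x.2.2.2 := fun x hx => div_pos (hpD' x hx) (hqD _)
  have eA : ∀ y, pAD q y * rA y = pAD p y := fun y => mul_div_cancel₀ _ (hqAD y).ne'
  have eC : ∀ y, pCD q y * rC y = pCD p y := fun y => mul_div_cancel₀ _ (hqCD y).ne'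
  have eD : ∀ y, pD q y * rD y = pD p y := fun y => mul_div_cancel₀ _ (hqD y).ne'
  have tA : ∑ y, pAD p y = 1 := by
    have := sum_pAD p (fun _ => 1)
    simpa [hp1] using this
  have tC : ∑ y, pCD p y = 1 := by
    have := sum_pCD p (fun _ => 1)
    simpa [hp1] using this
  have tD : ∑ y, pD p y = 1 := by
    have := sum_pD p (fun _ => 1)
    simpa [hp1] using this
  have kA : kl (pAD p) (pAD q) = ∑ x, p x * Real.log (rA (x.1, x.2.2.2)) :=
    sum_pAD p (fun y => Real.log (rA y))
  have kC : kl (pCD p) (pCD q) = ∑ x, p x * Real.log (rC x.2.2) :=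
    sum_pCD p (fun y => Real.log (rC y))
  have kD : kl (pD p) (pD q) = ∑ x, p x * Real.log (rD x.2.2.2) :=
    sum_pD p (fun y => Real.log (rD y))
  have lA : kl (pAD p) (pAD q) ≤ kl p q := by
    rw [kA]
    refine dv p q (fun x => rA (x.1, x.2.2.2)) hp0 hp1 hq0 (fun x => rA0 _) rA1 ?_
    rw [← sum_pAD q rA]
    simp only [eA, tA, le_refl]
  have lC : kl (pCD p) (pCD q) ≤ kl p q := by
    rw [kC]
    refine dv p q (fun x => rC x.2.2) hp0 hp1 hq0 (fun x => rC0 _) rC1 ?_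
    rw [← sum_pCD q rC]
    simp only [eC, tC, le_refl]
  have lD : kl (pD p) (pD q) ≤ kl p q := by
    rw [kD]
    refine dv p q (fun x => rD x.2.2.2) hp0 hp1 hq0 (fun x => rD0 _) rD1 ?_
    rw [← sum_pD q rD]
    simp only [eD, tD, le_refl]
  set s := ⨆ x : ιA × ιC × ιD, |Real.exp (mcmiCl q x) - 1| with hs
  have hs0 : 0 ≤ s := Real.iSup_nonneg fun x => abs_nonneg _
  have hsle : ∀ x, |Real.exp (mcmiCl q x) - 1| ≤ s := fun x =>
    le_ciSup (f := fun x => |Real.exp (mcmiCl q x) - 1|) (Set.finite_range _).bddAbove x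
  rcases le_total s 1 with hs1 | hs1
  swap
  · have := mul_nonneg (sub_nonneg.2 hs1) (sub_nonneg.2 lD)
    nlinarith
  set t : ℝ := 1 / (1 + s) with ht
  have ht1 : (1 + s) * t = 1 := by rw [ht]; field_simp
  have main : ∑ x, p x * Real.log (rD x.2.2.2 * ((rA (x.1, x.2.2.2) / rD x.2.2.2) ^ t
      * (rC x.2.2 / rD x.2.2.2) ^ t)) ≤ kl p q := by
    refine dv p q (fun x => rD x.2.2.2 * ((rA (x.1, x.2.2.2) / rD x.2.2.2) ^ t
      * (rC x.2.2 / rD x.2.2.2) ^ t)) hp0 hp1 hq0 ?_ ?_ ?_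
    · intro x
      have := rA0 (x.1, x.2.2.2)
      have := rC0 x.2.2
      have := rD0 x.2.2.2
      positivity
    · intro x hx
      have := rA1 x hx
      have := rC1 x hx
      have := rD1 x hx
      positivity
    · have h := sum_pACD q (fun a c d => rD d * ((rA (a, d) / rD d) ^ t * (rC (c, d) / rD d) ^ t))
      refine h.symm.le.trans ?_
      rw [← tD]
      refine Finset.sum_le_sum fun d _ => ?_
      rcases (rD0 d).lt_or_eq with hd | hd
      swap
      · simp only [← hd, zero_mul, mul_zero, Finset.sum_const_zero]
        exact hpD d
      have hQ := hqD d
      have hroot : ∀ z : ℝ, 0 ≤ z → (z ^ t) ^ (1 + s) = z := by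
        intro z hz
        rw [← Real.rpow_mul hz, mul_comm, ht1, Real.rpow_one]
      have key := two_var (fun a => pAD q (a, d) / pD q d) (fun a => (rA (a, d) / rD d) ^ t)
        (fun c => pCD q (c, d) / pD q d) (fun c => (rC (c, d) / rD d) ^ t)
        (fun a c => pACD q (a, c, d) / pD q d) hs0 hs1
        (fun a => div_pos (hqAD _) hQ) (fun c => div_pos (hqCD _) hQ)
        (by rw [← Finset.sum_div, marg_AD_D, div_self hQ.ne'])
        (by rw [← Finset.sum_div, marg_CD_D, div_self hQ.ne'])
        (fun a => by rw [← Finset.sum_div, marg_ACD_AD])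
        (fun c => by rw [← Finset.sum_div, marg_ACD_CD])
        (fun a c => by
          have h1 := hsle (a, c, d)
          have h2 : Real.exp (mcmiCl q (a, c, d))
              = pACD q (a, c, d) * pD q d / pAD q (a, d) / pCD q (c, d) := by
            simp only [mcmiCl]
            rw [Real.exp_sub, Real.exp_sub, Real.exp_add, Real.exp_log (hqACD _),
              Real.exp_log hQ, Real.exp_log (hqAD _), Real.exp_log (hqCD _)]
          have hA := hqAD (a, d)
          have hC := hqCD (c, d)
          have h3 : pACD q (a, c, d) / pD q d - pAD q (a, d) / pD q d * (pCD q (c, d) / pD q d)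
              = (pAD q (a, d) / pD q d * (pCD q (c, d) / pD q d))
                * (Real.exp (mcmiCl q (a, c, d)) - 1) := by
            rw [h2]; field_simp
          have h4 : 0 < pAD q (a, d) / pD q d * (pCD q (c, d) / pD q d) := by positivity
          rw [h3, abs_mul, abs_of_pos h4, mul_comm s]
          exact mul_le_mul_of_nonneg_left h1 h4.le)
        (fun a => Real.rpow_nonneg (div_nonneg (rA0 _) hd.le) _)
        (fun c => Real.rpow_nonneg (div_nonneg (rC0 _) hd.le) _)
        (by
          have : ∀ a, pAD q (a, d) / pD q d * ((rA (a, d) / rD d) ^ t) ^ (1 + s)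
              = pAD p (a, d) / pD p d := by
            intro a
            rw [hroot _ (div_nonneg (rA0 _) hd.le), div_mul_div_comm, eA, eD]
          simp only [this]
          rw [← Finset.sum_div, marg_AD_D, ← eD, div_self (mul_pos hQ hd).ne'])
        (by
          have : ∀ c, pCD q (c, d) / pD q d * ((rC (c, d) / rD d) ^ t) ^ (1 + s)
              = pCD p (c, d) / pD p d := by
            intro c
            rw [hroot _ (div_nonneg (rC0 _) hd.le), div_mul_div_comm, eC, eD]
          simp only [this]
          rw [← Finset.sum_div, marg_CD_D, ← eD, div_self (mul_pos hQ hd).ne'])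
      have h5 := mul_le_mul_of_nonneg_left key (mul_pos hQ hd).le
      rw [mul_one, eD] at h5
      refine le_trans (le_of_eq ?_) h5
      rw [← eD, Finset.mul_sum]
      refine Finset.sum_congr rfl fun a _ => ?_
      rw [Finset.mul_sum]
      refine Finset.sum_congr rfl fun c _ => ?_
      field_simp
  have hsum : ∑ x, p x * Real.log (rD x.2.2.2 * ((rA (x.1, x.2.2.2) / rD x.2.2.2) ^ t
      * (rC x.2.2 / rD x.2.2.2) ^ t)) = kl (pD p) (pD q)
        + t * (kl (pAD p) (pAD q) - kl (pD p) (pD q))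
        + t * (kl (pCD p) (pCD q) - kl (pD p) (pD q)) := by
    rw [kA, kC, kD, ← Finset.sum_sub_distrib, ← Finset.sum_sub_distrib, Finset.mul_sum,
      Finset.mul_sum, ← Finset.sum_add_distrib, ← Finset.sum_add_distrib]
    refine Finset.sum_congr rfl fun x _ => ?_
    rcases (hp0 x).lt_or_eq with h | h
    · have hA := rA1 x h
      have hC := rC1 x h
      have hD := rD1 x h
      have h1 : 0 < rA (x.1, x.2.2.2) / rD x.2.2.2 := div_pos hA hD
      have h2 : 0 < rC x.2.2 / rD x.2.2.2 := div_pos hC hD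
      rw [Real.log_mul hD.ne' (by positivity), Real.log_mul (by positivity) (by positivity),
        Real.log_rpow h1, Real.log_rpow h2, Real.log_div hA.ne' hD.ne', Real.log_div hC.ne' hD.ne']
      ring
    · rw [← h]; ring
  rw [hsum] at main
  have h6 := mul_le_mul_of_nonneg_left main (by linarith : 0 ≤ 1 + s)
  have h7 : (1 + s) * (kl (pD p) (pD q)
        + t * (kl (pAD p) (pAD q) - kl (pD p) (pD q))
        + t * (kl (pCD p) (pCD q) - kl (pD p) (pD q)))
      = (1 + s) * kl (pD p) (pD q) + ((1 + s) * t) * (kl (pAD p) (pAD q) - kl (pD p) (pD q))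
        + ((1 + s) * t) * (kl (pCD p) (pCD q) - kl (pD p) (pD q)) := by ring
  rw [h7, ht1] at h6
  linarith

end Paper
end
end

section
/- Pimsner–Popa index bound for local Davies conditional expectations: if E_A acts nontrivially only on A∂ and E_A(e^{−βH_{A∂}}) = e^{−βH_{A∂}} with ‖H_{A∂}‖_∞ ≤ gJ|A∂|, then the complete Pimsner–Popa index satisfies C_cb(E_A) ≤ d^{3|A∂|} e^{2βgJ|A∂|}, where d is the local dimension. -/
open scoped BigOperators Matrix Classical ComplexOrder

noncomputable section

namespace Paper

variable {n : Type*} [Fintype n] [DecidableEq n]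

/-- `F` is the Hilbert–Schmidt (Heisenberg) dual of the Schrödinger-picture map `E`. -/
def IsDual (E F : Matrix n n ℂ →ₗ[ℂ] Matrix n n ℂ) : Prop :=
  ∀ X Y, Matrix.trace (E X * Y) = Matrix.trace (X * F Y)

/-- GNS symmetry of a (Heisenberg-picture) map `F` with respect to the state `σ`:
self-adjointness for the GNS inner product `⟨X, Y⟩ = Tr[X† σ Y]`. -/
def GNSSymmetric (σ : Matrix n n ℂ) (F : Matrix n n ℂ →ₗ[ℂ] Matrix n n ℂ) : Prop :=
  ∀ X Y, Matrix.trace (Xᴴ * σ * F Y) = Matrix.trace ((F X)ᴴ * σ * Y)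

/-- `E` (Schrödinger picture, with Heisenberg dual `F`) is a conditional expectation onto a
von Neumann subalgebra, GNS-symmetric with respect to the full-rank invariant state `σ`. -/
structure IsGNSCondExp (σ : Matrix n n ℂ) (E F : Matrix n n ℂ →ₗ[ℂ] Matrix n n ℂ) : Prop where
  dual : IsDual E F
  idem : ∀ X, E (E X) = E X
  pos : ∀ X, X.PosSemidef → (E X).PosSemidef
  tracePreserving : ∀ X, (E X).trace = X.trace
  unital : F 1 = 1
  bimodule : ∀ X Y Z, F (F X * Y * F Z) = F X * F Y * F Z
  invariant : E σ = σ
  gns : GNSSymmetric σ F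

end Paper
namespace Paper

variable {n : Type*} [Fintype n] [DecidableEq n]

/-- Blockwise amplification `id_{Fin m} ⊗ E` of a linear map `E` on matrices. -/
def amplify (m : ℕ) (E : Matrix n n ℂ →ₗ[ℂ] Matrix n n ℂ)
    (X : Matrix (Fin m × n) (Fin m × n) ℂ) : Matrix (Fin m × n) (Fin m × n) ℂ :=
  fun p q => E (Matrix.of fun a b => X (p.1, a) (q.1, b)) p.2 q.2

/-- The Pimsner–Popa index of a map `E` on matrices:
`C(E) = inf{c ≥ 0 : ρ ≤ c·E(ρ) for all states ρ}`. -/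
def ppIndex (E : Matrix n n ℂ → Matrix n n ℂ) : ℝ :=
  sInf {c : ℝ | 0 ≤ c ∧ ∀ ρ, IsState ρ → (c • E ρ - ρ).PosSemidef}

/-- The complete Pimsner–Popa index `C_cb(E) = sup_R C(id_R ⊗ E)`. -/
def ppIndexCb (E : Matrix n n ℂ →ₗ[ℂ] Matrix n n ℂ) : ℝ :=
  ⨆ m : ℕ, ppIndex (amplify m E)

variable {Λ : Type*} [Fintype Λ] [DecidableEq Λ] {dloc : ℕ}

/-- An operator on a lattice of qudits is supported on the region `T` if it is of the form
`M_T ⊗ Id` for some operator `M_T` on `T`. -/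
def SupportedOn (T : Finset Λ)
    (Y : Matrix (∀ _ : Λ, Fin dloc) (∀ _ : Λ, Fin dloc) ℂ) : Prop :=
  ∃ M : Matrix (∀ k : {k : Λ // k ∈ T}, Fin dloc) (∀ k : {k : Λ // k ∈ T}, Fin dloc) ℂ,
    Y = fun x y => if ∀ k ∉ T, x k = y k then M (fun k => x k.1) (fun k => y k.1) else 0

/-- A map on a lattice of qudits acts nontrivially only on the region `T` if it commutes
with (left and right) multiplication by every operator supported outside `T`. -/
def ActsOnlyOn (T : Finset Λ)
    (E : Matrix (∀ _ : Λ, Fin dloc) (∀ _ : Λ, Fin dloc) ℂ →ₗ[ℂ]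
      Matrix (∀ _ : Λ, Fin dloc) (∀ _ : Λ, Fin dloc) ℂ) : Prop :=
  ∀ Y, SupportedOn (Finset.univ \ T) Y →
    ∀ X, E (Y * X) = Y * E X ∧ E (X * Y) = E X * Y

end Paper
namespace Paper

set_option linter.unusedSectionVars false

section helpers
variable {n : Type*} [Fintype n] [DecidableEq n]

lemma matFun_mul {a : Matrix n n ℂ} (h : a.IsHermitian) (f g : ℝ → ℝ) :
    matFun f a * matFun g a = matFun (fun t => f t * g t) a := by
  have hU : (star h.eigenvectorUnitary : Matrix n n ℂ) * (h.eigenvectorUnitary : Matrix n n ℂ) = 1 :=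
    Unitary.coe_star_mul_self _
  simp only [matFun, dif_pos h]
  calc _ = (h.eigenvectorUnitary : Matrix n n ℂ) *
      (Matrix.diagonal (fun i => (f (h.eigenvalues i) : ℂ)) *
      ((star h.eigenvectorUnitary : Matrix n n ℂ) * (h.eigenvectorUnitary : Matrix n n ℂ)) *
      Matrix.diagonal (fun i => (g (h.eigenvalues i) : ℂ))) *
      (star h.eigenvectorUnitary : Matrix n n ℂ) := by simp only [Matrix.mul_assoc]
    _ = _ := by
      rw [hU, Matrix.mul_one, Matrix.diagonal_mul_diagonal]
      simp

lemma matFun_sub {a : Matrix n n ℂ} (h : a.IsHermitian) (f g : ℝ → ℝ) :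
    matFun f a - matFun g a = matFun (fun t => f t - g t) a := by
  simp only [matFun, dif_pos h]
  rw [← Matrix.sub_mul, ← Matrix.mul_sub, Matrix.diagonal_sub]
  simp

lemma matFun_const {a : Matrix n n ℂ} (h : a.IsHermitian) (c : ℝ) :
    matFun (fun _ => c) a = (c : ℂ) • 1 := by
  have hU : (h.eigenvectorUnitary : Matrix n n ℂ) * (star h.eigenvectorUnitary : Matrix n n ℂ) = 1 :=
    Unitary.coe_mul_star_self _
  simp only [matFun, dif_pos h]
  rw [← Matrix.smul_one_eq_diagonal, Matrix.mul_smul, Matrix.mul_one, Matrix.smul_mul, hU]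

lemma matFun_id {a : Matrix n n ℂ} (h : a.IsHermitian) : matFun (fun t => t) a = a := by
  simp only [matFun, dif_pos h]
  conv_rhs => rw [h.spectral_theorem]
  rfl

lemma matFun_trace {a : Matrix n n ℂ} (h : a.IsHermitian) (f : ℝ → ℝ) :
    (matFun f a).trace = ∑ i, (f (h.eigenvalues i) : ℂ) := by
  have hU : (star h.eigenvectorUnitary : Matrix n n ℂ) * (h.eigenvectorUnitary : Matrix n n ℂ) = 1 :=
    Unitary.coe_star_mul_self _
  simp only [matFun, dif_pos h]
  rw [Matrix.trace_mul_comm, ← Matrix.mul_assoc, hU, Matrix.one_mul, Matrix.trace_diagonal]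

lemma matFun_congr {a : Matrix n n ℂ} (h : a.IsHermitian) {f g : ℝ → ℝ}
    (hfg : ∀ i, f (h.eigenvalues i) = g (h.eigenvalues i)) : matFun f a = matFun g a := by
  simp only [matFun, dif_pos h, hfg]

lemma matFun_posSemidef {a : Matrix n n ℂ} (h : a.IsHermitian) {f : ℝ → ℝ}
    (hf : ∀ i, 0 ≤ f (h.eigenvalues i)) : (matFun f a).PosSemidef := by
  simp only [matFun, dif_pos h]
  apply Matrix.PosSemidef.mul_mul_conjTranspose_same
  apply Matrix.PosSemidef.diagonal
  intro i
  simpa using hf i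

lemma matFun_herm {a : Matrix n n ℂ} (h : a.IsHermitian) (f : ℝ → ℝ) :
    (matFun f a).IsHermitian := by
  simp only [matFun, dif_pos h]
  apply Matrix.isHermitian_mul_mul_conjTranspose
  apply Matrix.isHermitian_diagonal_of_self_adjoint
  ext i
  simp

lemma matFun_poly {a : Matrix n n ℂ} (h : a.IsHermitian) (f : ℝ → ℝ) :
    ∃ p : Polynomial ℂ, matFun f a = Polynomial.aeval a p := by
  let s : Finset ℝ := Finset.univ.image h.eigenvalues
  let p : Polynomial ℂ := Lagrange.interpolate s (fun t : ℝ => (t : ℂ)) (fun t => (f t : ℂ))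
  have hp : ∀ i, p.eval (h.eigenvalues i : ℂ) = f (h.eigenvalues i) := by
    intro i
    refine Lagrange.eval_interpolate_at_node (i := h.eigenvalues i) (fun t : ℝ => (f t : ℂ)) ?_ ?_
    · intro x _ y _ hxy
      exact Complex.ofReal_injective hxy
    · simp [s]
  refine ⟨p, ?_⟩
  conv_rhs => rw [h.spectral_theorem]
  rw [Polynomial.aeval_algHom_apply]
  have : Polynomial.aeval (Matrix.diagonal (RCLike.ofReal ∘ h.eigenvalues) : Matrix n n ℂ) p
      = Matrix.diagonal (fun i => (f (h.eigenvalues i) : ℂ)) := by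
    have h2 := Polynomial.aeval_algHom_apply (Matrix.diagonalAlgHom (n := n) (α := ℂ) ℂ)
      (RCLike.ofReal ∘ h.eigenvalues : n → ℂ) p
    simp only [Matrix.diagonalAlgHom_apply] at h2
    rw [h2, Polynomial.aeval_pi_apply]
    congr 1
    funext i
    rw [← hp i, Polynomial.aeval_def, Polynomial.eval₂_eq_eval_map]
    simp
  rw [this]
  simp only [matFun, dif_pos h]
  rfl

lemma trace_mul_nonneg {A B : Matrix n n ℂ} (hA : A.PosSemidef) (hB : B.PosSemidef) :
    0 ≤ (A * B).trace := by
  have hs : matFun Real.sqrt B * matFun Real.sqrt B = B := by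
    rw [matFun_mul hB.1]
    conv_rhs => rw [← matFun_id hB.1]
    exact matFun_congr hB.1 fun i => Real.mul_self_sqrt (hB.eigenvalues_nonneg i)
  have hh := matFun_herm hB.1 Real.sqrt
  rw [← hs, ← Matrix.mul_assoc, Matrix.trace_mul_comm, ← Matrix.mul_assoc]
  have := (hA.mul_mul_conjTranspose_same (matFun Real.sqrt B)).trace_nonneg
  rwa [hh.eq] at this

lemma posSemidef_trace_sub {w : Matrix n n ℂ} (hw : w.PosSemidef) {c : ℝ} (hc : w.trace.re ≤ c) :
    ((c : ℂ) • 1 - w).PosSemidef := by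
  rw [← matFun_const hw.1 c]
  conv => arg 1; arg 2; rw [← matFun_id hw.1]
  rw [matFun_sub hw.1]
  apply matFun_posSemidef hw.1
  intro i
  have h1 : w.trace.re = ∑ i, hw.1.eigenvalues i := by
    conv_lhs => rw [← matFun_id hw.1]
    rw [matFun_trace hw.1]
    simp
  have h2 := Finset.single_le_sum (f := hw.1.eigenvalues) (fun j _ => hw.eigenvalues_nonneg j)
    (Finset.mem_univ i)
  linarith

/-- The subalgebra of fixed points of `F` commuting with `r`. -/
def fixAlg (F : Matrix n n ℂ →ₗ[ℂ] Matrix n n ℂ) (h1 : F 1 = 1)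
    (hbi : ∀ X Y Z, F (F X * Y * F Z) = F X * F Y * F Z) (r : Matrix n n ℂ) :
    Subalgebra ℂ (Matrix n n ℂ) where
  carrier := {y | F y = y ∧ y * r = r * y}
  mul_mem' := by
    rintro x y ⟨hx, hxr⟩ ⟨hy, hyr⟩
    refine ⟨?_, ?_⟩
    · have := hbi x 1 y
      rwa [hx, hy, h1, Matrix.mul_one] at this
    · rw [Matrix.mul_assoc, hyr, ← Matrix.mul_assoc, hxr, Matrix.mul_assoc]
  add_mem' := by
    rintro x y ⟨hx, hxr⟩ ⟨hy, hyr⟩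
    exact ⟨by rw [map_add, hx, hy], by rw [Matrix.add_mul, Matrix.mul_add, hxr, hyr]⟩
  algebraMap_mem' := by
    intro c
    rw [Algebra.algebraMap_eq_smul_one]
    exact ⟨by rw [map_smul, h1], by simp⟩

lemma core (F : Matrix n n ℂ →ₗ[ℂ] Matrix n n ℂ) (h1 : F 1 = 1)
    (hstar : ∀ X, F Xᴴ = (F X)ᴴ)
    (hbi : ∀ X Y Z, F (F X * Y * F Z) = F X * F Y * F Z)
    (G : Matrix n n ℂ) (l u c : ℝ) (hl : 0 < l)
    (hGl : (G - (l : ℂ) • 1).PosSemidef) (hGu : ((u : ℂ) • 1 - G).PosSemidef)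
    (hGF : ∀ X, (G * F X).trace = (G * X).trace)
    (q r : Matrix n n ℂ) (hq : q.PosSemidef) (hr : r.IsHermitian) (hrr : r * r = r)
    (hFr : F r = r) (hrq : r * q = q) (hqr : q * r = q)
    (hc : u * r.trace.re ≤ l * c) : ((c : ℂ) • F q - q).PosSemidef := by
  have ha : (F q).IsHermitian := by
    unfold Matrix.IsHermitian
    rw [← hstar, hq.1.eq]
  set a := F q with hadef
  have hidem : ∀ X, F (F X) = F X := by
    intro X
    have := hbi X 1 1
    simpa [h1] using this
  have hfa : F a = a := hidem q
  have hGpsd : G.PosSemidef := by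
    have h := hGl.add ((Matrix.PosSemidef.one (n := n) (R := ℂ)).smul (a := (l : ℂ))
      (by exact_mod_cast hl.le))
    simpa using h
  have hra : r * a = a := by
    have := hbi r q 1
    rw [hFr, h1, Matrix.mul_one, Matrix.mul_one, hrq] at this
    exact this.symm
  have har : a * r = a := by
    have := hbi 1 q r
    rw [hFr, h1, Matrix.one_mul, Matrix.one_mul, hqr] at this
    exact this.symm
  have hmem : a ∈ fixAlg F h1 hbi r := ⟨hfa, by rw [hra, har]⟩
  have hfun : ∀ f : ℝ → ℝ, F (matFun f a) = matFun f a ∧ matFun f a * r = r * matFun f a := by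
    intro f
    obtain ⟨p, hp⟩ := matFun_poly ha f
    rw [hp]
    have : Polynomial.aeval a p ∈ fixAlg F h1 hbi r := by
      have := Polynomial.aeval_mem_adjoin_singleton ℂ a (p := p)
      exact Algebra.adjoin_le (by simpa using hmem) this
    exact this
  have hconj : ∀ f : ℝ → ℝ, F (matFun f a * q * matFun f a) = matFun f a * a * matFun f a := by
    intro f
    have := hbi (matFun f a) q (matFun f a)
    rwa [(hfun f).1] at this
  have hlow : ∀ z : Matrix n n ℂ, z.PosSemidef → l * z.trace.re ≤ (G * z).trace.re := by
    intro z hz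
    have := trace_mul_nonneg hGl hz
    rw [Matrix.sub_mul, Matrix.trace_sub, Matrix.smul_mul, Matrix.one_mul, Matrix.trace_smul] at this
    have := (Complex.le_def.1 this).1
    simp at this
    linarith
  have hpq : ∀ f : ℝ → ℝ, (matFun f a * q * matFun f a).PosSemidef := by
    intro f
    have := hq.mul_mul_conjTranspose_same (matFun f a)
    rwa [(matFun_herm ha f).eq] at this
  -- positivity of `a`
  have hpos : ∀ i, 0 ≤ ha.eigenvalues i := by
    let f : ℝ → ℝ := fun t => if t < 0 then 1 else 0
    let k : ℝ → ℝ := fun t => if t < 0 then -t else 0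
    have hk : matFun k a = -(matFun f a * a * matFun f a) := by
      have h2 : matFun f a * a * matFun f a = matFun (fun t => f t * t * f t) a := by
        conv_lhs => arg 1; arg 2; rw [← matFun_id ha]
        rw [matFun_mul ha, matFun_mul ha]
      have h3 : -(matFun (fun t => f t * t * f t) a) = matFun (fun _ => 0) a - matFun (fun t => f t * t * f t) a := by
        rw [matFun_const ha]; simp
      rw [h2, h3, matFun_sub ha]
      apply matFun_congr ha
      intro i
      simp only [f, k]
      split_ifs <;> simp
    have hk0 : ∀ t, 0 ≤ k t := by
      intro t; simp only [k]; split_ifs <;> linarith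
    have hkp : (matFun k a).PosSemidef := matFun_posSemidef ha fun i => hk0 _
    have e1 := hlow _ hkp
    have e2 : (G * matFun k a).trace.re ≤ 0 := by
      rw [hk, ← hconj, Matrix.mul_neg, Matrix.trace_neg, hGF]
      have := (Complex.le_def.1 (trace_mul_nonneg hGpsd (hpq f))).1
      simp at this ⊢
      exact this
    have e3 : (matFun k a).trace.re ≤ 0 := by nlinarith
    rw [matFun_trace ha] at e3
    simp only [Complex.re_sum, Complex.ofReal_re] at e3
    intro i
    have e4 := Finset.single_le_sum (f := fun i => k (ha.eigenvalues i)) (fun j _ => hk0 _)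
      (Finset.mem_univ i)
    have e5 : k (ha.eigenvalues i) ≤ 0 := le_trans e4 e3
    by_contra hneg
    push Not at hneg
    simp only [k, if_pos hneg] at e5
    linarith
  -- regularised inequality
  have hreg : ∀ ε : ℝ, 0 < ε → ((c : ℂ) • (a + (ε : ℂ) • 1) - q).PosSemidef := by
    intro ε hε
    let f : ℝ → ℝ := fun t => 1 / Real.sqrt (t + ε)
    let f' : ℝ → ℝ := fun t => Real.sqrt (t + ε)
    set x := matFun f a with hx
    set x' := matFun f' a with hx'
    have hsq : ∀ i, 0 < Real.sqrt (ha.eigenvalues i + ε) := fun i =>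
      Real.sqrt_pos.2 (by have := hpos i; linarith)
    have hsq2 : ∀ i, Real.sqrt (ha.eigenvalues i + ε) * Real.sqrt (ha.eigenvalues i + ε)
        = ha.eigenvalues i + ε := fun i =>
      Real.mul_self_sqrt (by have := hpos i; linarith)
    have hxx' : x' * x = 1 := by
      rw [hx, hx', matFun_mul ha]
      rw [matFun_congr ha (g := fun _ => 1), matFun_const ha]
      · simp
      · intro i
        simp only [f, f']
        field_simp [(hsq i).ne']
    have hx'x : x * x' = 1 := by
      rw [hx, hx', matFun_mul ha]
      rw [matFun_congr ha (g := fun _ => 1), matFun_const ha]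
      · simp
      · intro i
        simp only [f, f']
        field_simp [(hsq i).ne']
    have hx'2 : x' * x' = a + (ε : ℂ) • 1 := by
      have h2 : a + (ε : ℂ) • 1 = matFun (fun t => t) a - matFun (fun _ => -ε) a := by
        rw [matFun_id ha, matFun_const ha]; simp
      rw [h2, hx', matFun_mul ha, matFun_sub ha]
      apply matFun_congr ha
      intro i
      simp only [f', hsq2]
      ring
    have hxh : xᴴ = x := (matFun_herm ha f).eq
    have hx'h : x'ᴴ = x' := (matFun_herm ha f').eq
    have hxr : x * r = r * x := (hfun f).2
    have hxax : x * a * x = 1 - (ε : ℂ) • (x * x) := by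
      have : a = x' * x' - (ε : ℂ) • 1 := by rw [hx'2]; simp
      rw [this, Matrix.mul_sub, Matrix.sub_mul, ← Matrix.mul_assoc, hx'x, Matrix.one_mul, hxx']
      simp
    have hFw : F (x * q * x) = r - (ε : ℂ) • ((x * r)ᴴ * (x * r)) := by
      rw [hconj]
      change x * a * x = _
      have : x * a * x = r * (x * a * x) * r := by
        conv_lhs => rw [← hra, ← har]
        simp only [Matrix.mul_assoc]
        rw [← hxr, ← Matrix.mul_assoc x r, hxr]
        simp only [Matrix.mul_assoc]
      rw [this, hxax, Matrix.mul_sub, Matrix.sub_mul, Matrix.mul_one, hrr,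
        Matrix.conjTranspose_mul, hxh, hr.eq]
      simp [Matrix.mul_assoc]
    have hw := hpq f
    change (x * q * x).PosSemidef at hw
    have t1 := hlow _ hw
    have t2 : (G * (x * q * x)).trace.re ≤ (G * r).trace.re := by
      rw [← hGF, hFw, Matrix.mul_sub, Matrix.trace_sub, Matrix.mul_smul, Matrix.trace_smul]
      have := (Complex.le_def.1 (trace_mul_nonneg hGpsd
        (Matrix.posSemidef_conjTranspose_mul_self (x * r)))).1
      simp only [Complex.zero_re] at this
      simp only [Complex.sub_re, smul_eq_mul, Complex.re_ofReal_mul]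
      nlinarith
    have hrp : r.PosSemidef := by
      have := Matrix.posSemidef_conjTranspose_mul_self r
      rwa [hr.eq, hrr] at this
    have t3 : (G * r).trace.re ≤ u * r.trace.re := by
      have := trace_mul_nonneg hGu hrp
      rw [Matrix.sub_mul, Matrix.trace_sub, Matrix.smul_mul, Matrix.one_mul, Matrix.trace_smul] at this
      have := (Complex.le_def.1 this).1
      simp at this
      linarith
    have t4 : (x * q * x).trace.re ≤ c := by
      have : l * (x * q * x).trace.re ≤ l * c := by linarith
      exact le_of_mul_le_mul_left this hl
    have t5 := (posSemidef_trace_sub hw t4).mul_mul_conjTranspose_same x'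
    rw [hx'h, Matrix.mul_sub, Matrix.sub_mul, Matrix.mul_smul, Matrix.smul_mul, Matrix.mul_one,
      hx'2] at t5
    have t6 : x' * (x * q * x) * x' = q := by
      calc _ = (x' * x) * q * (x * x') := by simp only [Matrix.mul_assoc]
        _ = q := by rw [hxx', hx'x]; simp
    rwa [t6] at t5
  -- limit
  refine Matrix.PosSemidef.of_dotProduct_mulVec_nonneg ?_ ?_
  · have h2 : (((c : ℂ)) • a).IsHermitian := by
      unfold Matrix.IsHermitian
      rw [Matrix.conjTranspose_smul, ha.eq]; simp
    exact h2.sub hq.1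
  · intro v
    have hlim : Filter.Tendsto (fun ε : ℝ => star v ⬝ᵥ (((c : ℂ) • (a + (ε : ℂ) • 1) - q) *ᵥ v))
        (nhdsWithin 0 (Set.Ioi 0)) (nhds (star v ⬝ᵥ (((c : ℂ) • a - q) *ᵥ v))) := by
      have hcont : Continuous (fun ε : ℝ => star v ⬝ᵥ (((c : ℂ) • (a + (ε : ℂ) • 1) - q) *ᵥ v)) := by
        have : Continuous (fun ε : ℝ => (((c : ℂ) • (a + (ε : ℂ) • 1) - q))) := by fun_prop
        exact Continuous.dotProduct continuous_const (this.matrix_mulVec continuous_const)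
      have := hcont.tendsto 0
      simp only [Complex.ofReal_zero, zero_smul, add_zero] at this
      exact this.mono_left nhdsWithin_le_nhds
    refine ge_of_tendsto hlim ?_
    filter_upwards [self_mem_nhdsWithin] with ε hε
    exact (hreg ε hε).dotProduct_mulVec_nonneg v

end helpers

section amp
variable {n : Type*} [Fintype n] [DecidableEq n] {m : ℕ}

/-- The `(i, j)` block of a matrix. -/
def blk (X : Matrix (Fin m × n) (Fin m × n) ℂ) (i j : Fin m) : Matrix n n ℂ :=
  Matrix.of fun a b => X (i, a) (j, b)

lemma blk_ext {X Y : Matrix (Fin m × n) (Fin m × n) ℂ} (h : ∀ i j, blk X i j = blk Y i j) :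
    X = Y := by
  ext ⟨i, a⟩ ⟨j, b⟩
  exact congrFun (congrFun (h i j) a) b

lemma blk_amplify (E : Matrix n n ℂ →ₗ[ℂ] Matrix n n ℂ) (X : Matrix (Fin m × n) (Fin m × n) ℂ)
    (i j : Fin m) : blk (amplify m E X) i j = E (blk X i j) := rfl

lemma blk_mul (X Y : Matrix (Fin m × n) (Fin m × n) ℂ) (i j : Fin m) :
    blk (X * Y) i j = ∑ k, blk X i k * blk Y k j := by
  ext a b
  simp [blk, Matrix.mul_apply, Fintype.sum_prod_type, Matrix.sum_apply]

lemma blk_conjTranspose (X : Matrix (Fin m × n) (Fin m × n) ℂ) (i j : Fin m) :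
    blk Xᴴ i j = (blk X j i)ᴴ := rfl

lemma blk_one (i j : Fin m) :
    blk (1 : Matrix (Fin m × n) (Fin m × n) ℂ) i j = if i = j then 1 else 0 := by
  ext a b
  by_cases h : i = j <;> by_cases h' : a = b <;> simp [blk, Matrix.one_apply, h, h']

lemma blk_trace (X : Matrix (Fin m × n) (Fin m × n) ℂ) : X.trace = ∑ i, (blk X i i).trace := by
  simp [blk, Matrix.trace, Fintype.sum_prod_type]

/-- The amplification as a linear map. -/
def ampLin (m : ℕ) (E : Matrix n n ℂ →ₗ[ℂ] Matrix n n ℂ) :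
    Matrix (Fin m × n) (Fin m × n) ℂ →ₗ[ℂ] Matrix (Fin m × n) (Fin m × n) ℂ where
  toFun := amplify m E
  map_add' X Y := by
    refine blk_ext fun i j => ?_
    change E (blk X i j + blk Y i j) = E (blk X i j) + E (blk Y i j)
    rw [map_add]
  map_smul' c X := by
    refine blk_ext fun i j => ?_
    change E (c • blk X i j) = c • E (blk X i j)
    rw [map_smul]

lemma blk_ampLin (E : Matrix n n ℂ →ₗ[ℂ] Matrix n n ℂ) (X : Matrix (Fin m × n) (Fin m × n) ℂ)
    (i j : Fin m) : blk (ampLin m E X) i j = E (blk X i j) := rfl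

lemma amp_bimodule (F : Matrix n n ℂ →ₗ[ℂ] Matrix n n ℂ)
    (hbi : ∀ X Y Z, F (F X * Y * F Z) = F X * F Y * F Z)
    (X Y Z : Matrix (Fin m × n) (Fin m × n) ℂ) :
    ampLin m F (ampLin m F X * Y * ampLin m F Z) = ampLin m F X * ampLin m F Y * ampLin m F Z := by
  refine blk_ext fun i j => ?_
  simp only [blk_ampLin, blk_mul, map_sum, Finset.sum_mul, hbi]

lemma amp_one (F : Matrix n n ℂ →ₗ[ℂ] Matrix n n ℂ) (h1 : F 1 = 1) : ampLin m F 1 = 1 := by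
  refine blk_ext fun i j => ?_
  rw [blk_ampLin, blk_one]
  split_ifs <;> simp [h1]

lemma amp_star (F : Matrix n n ℂ →ₗ[ℂ] Matrix n n ℂ) (h : ∀ X, F Xᴴ = (F X)ᴴ)
    (X : Matrix (Fin m × n) (Fin m × n) ℂ) : ampLin m F Xᴴ = (ampLin m F X)ᴴ := by
  refine blk_ext fun i j => ?_
  simp only [blk_ampLin, blk_conjTranspose, h]

lemma amp_dual {E F : Matrix n n ℂ →ₗ[ℂ] Matrix n n ℂ} (h : IsDual E F) :
    IsDual (ampLin m E) (ampLin m F) := by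
  intro X Y
  simp only [blk_trace, blk_mul, Matrix.trace_sum, blk_ampLin]
  exact Finset.sum_congr rfl fun i _ => Finset.sum_congr rfl fun k _ => h _ _

open scoped Kronecker in
lemma blk_kron (G : Matrix n n ℂ) (i j : Fin m) :
    blk ((1 : Matrix (Fin m) (Fin m) ℂ) ⊗ₖ G) i j = if i = j then G else 0 := by
  ext a b
  by_cases h : i = j <;> simp [blk, Matrix.one_apply, h]

open scoped Kronecker in
lemma kron_sub (A B : Matrix n n ℂ) :
    (1 : Matrix (Fin m) (Fin m) ℂ) ⊗ₖ (A - B) = (1 : Matrix (Fin m) (Fin m) ℂ) ⊗ₖ A -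
      (1 : Matrix (Fin m) (Fin m) ℂ) ⊗ₖ B := by
  ext i j
  simp [mul_sub]

open scoped Kronecker in
lemma amp_trace {E F : Matrix n n ℂ →ₗ[ℂ] Matrix n n ℂ} (h : IsDual E F) {G : Matrix n n ℂ}
    (hG : E G = G) (X : Matrix (Fin m × n) (Fin m × n) ℂ) :
    (((1 : Matrix (Fin m) (Fin m) ℂ) ⊗ₖ G) * ampLin m F X).trace =
      (((1 : Matrix (Fin m) (Fin m) ℂ) ⊗ₖ G) * X).trace := by
  rw [← amp_dual h]
  congr 2
  refine blk_ext fun i j => ?_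
  rw [blk_ampLin, blk_kron]
  split_ifs <;> simp [hG]

lemma E_star {E : Matrix n n ℂ →ₗ[ℂ] Matrix n n ℂ}
    (hpos : ∀ X : Matrix n n ℂ, X.PosSemidef → (E X).PosSemidef) (X : Matrix n n ℂ) :
    E Xᴴ = (E X)ᴴ := by
  have hherm : ∀ X : Matrix n n ℂ, X.IsHermitian → (E X).IsHermitian := by
    intro X hX
    have : X = matFun (fun t => max t 0) X - matFun (fun t => max (-t) 0) X := by
      rw [matFun_sub hX]
      conv_lhs => rw [← matFun_id hX]
      apply matFun_congr hX
      intro i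
      rcases le_total (hX.eigenvalues i) 0 with h | h
      · rw [max_eq_right h, max_eq_left (by linarith)]; ring
      · rw [max_eq_left h, max_eq_right (by linarith)]; ring
    rw [this, map_sub]
    exact (hpos _ (matFun_posSemidef hX fun i => le_max_right _ _)).1.sub
      (hpos _ (matFun_posSemidef hX fun i => le_max_right _ _)).1
  have hA : (X + Xᴴ).IsHermitian := Matrix.isHermitian_add_transpose_self X
  have hB : (Complex.I • (X - Xᴴ)).IsHermitian := by
    unfold Matrix.IsHermitian
    rw [Matrix.conjTranspose_smul, Matrix.conjTranspose_sub, Matrix.conjTranspose_conjTranspose]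
    simp only [Complex.star_def, Complex.conj_I, smul_sub, neg_smul]
    abel
  have h1 := (hherm _ hA).eq
  have h2 := (hherm _ hB).eq
  simp only [map_add, map_smul, map_sub, Matrix.conjTranspose_add, Matrix.conjTranspose_smul,
    Matrix.conjTranspose_sub, Complex.star_def, Complex.conj_I, neg_smul] at h1 h2
  rw [← smul_neg, (smul_right_injective _ Complex.I_ne_zero).eq_iff] at h2
  have h3 : (2 : ℂ) • (E Xᴴ) = (2 : ℂ) • (E X)ᴴ := by
    rw [two_smul, two_smul]
    have h4 : (E X)ᴴ = E X + E Xᴴ - (E Xᴴ)ᴴ := by rw [← h1]; abel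
    have h5 : (E X)ᴴ = (E Xᴴ)ᴴ - (E X - E Xᴴ) := by rw [← h2]; abel
    nth_rewrite 1 [h4]
    rw [h5]
    abel
  exact smul_right_injective _ two_ne_zero h3

lemma F_star {E F : Matrix n n ℂ →ₗ[ℂ] Matrix n n ℂ} (h : IsDual E F)
    (hE : ∀ X, E Xᴴ = (E X)ᴴ) (X : Matrix n n ℂ) : F Xᴴ = (F X)ᴴ := by
  rw [Matrix.ext_iff_trace_mul_left]
  intro Y
  rw [← h]
  have e1 : (Y * (F X)ᴴ).trace = star ((Yᴴ * F X).trace) := by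
    rw [← Matrix.trace_conjTranspose, Matrix.conjTranspose_mul, Matrix.conjTranspose_conjTranspose,
      Matrix.trace_mul_comm]
  rw [e1, ← h, ← Matrix.trace_conjTranspose, Matrix.conjTranspose_mul, hE,
    Matrix.conjTranspose_conjTranspose, Matrix.trace_mul_comm]

lemma eig_le_opNorm {A : Matrix n n ℂ} (hA : A.IsHermitian) (i : n) :
    |hA.eigenvalues i| ≤ opNorm A := by
  have h := ContinuousLinearMap.le_opNorm
    (LinearMap.toContinuousLinearMap (Matrix.toEuclideanLin A)) (hA.eigenvectorBasis i)
  have h2 : (LinearMap.toContinuousLinearMap (Matrix.toEuclideanLin A)) (hA.eigenvectorBasis i)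
      = (hA.eigenvalues i) • hA.eigenvectorBasis i := by
    have := hA.mulVec_eigenvectorBasis i
    apply (WithLp.ofLp_injective 2)
    simpa using this
  rw [h2, norm_smul, hA.eigenvectorBasis.norm_eq_one] at h
  simpa [opNorm] using h

lemma opNorm_smul (A : Matrix n n ℂ) (c : ℝ) : opNorm (c • A) = |c| * opNorm A := by
  have : c • A = (c : ℂ) • A := by ext i j; simp
  unfold opNorm
  rw [this, map_smul, map_smul, norm_smul]
  simp

lemma matExp_bounds {A : Matrix n n ℂ} (hA : A.IsHermitian) {b : ℝ} (hb : opNorm A ≤ b) :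
    (matExp A - ((Real.exp (-b) : ℝ) : ℂ) • 1).PosSemidef ∧
    (((Real.exp b : ℝ) : ℂ) • 1 - matExp A).PosSemidef := by
  unfold matExp
  have hi := fun i => abs_le.1 ((eig_le_opNorm hA i).trans hb)
  constructor
  · rw [← matFun_const hA, matFun_sub hA]
    exact matFun_posSemidef hA fun i => sub_nonneg.2 (Real.exp_le_exp.2 (hi i).1)
  · rw [← matFun_const hA, matFun_sub hA]
    exact matFun_posSemidef hA fun i => sub_nonneg.2 (Real.exp_le_exp.2 (hi i).2)

lemma exists_proj {B : Type*} [Fintype B] (M : Matrix n B ℂ) :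
    ∃ P : Matrix n n ℂ, P.IsHermitian ∧ P * P = P ∧ P * M = M ∧ P.trace.re ≤ Fintype.card B := by
  have hS : (M * Mᴴ).IsHermitian := Matrix.isHermitian_mul_conjTranspose_self M
  let f : ℝ → ℝ := fun t => if t ≠ 0 then 1 else 0
  refine ⟨matFun f (M * Mᴴ), matFun_herm hS f, ?_, ?_, ?_⟩
  · rw [matFun_mul hS]
    apply matFun_congr hS
    intro i
    simp only [f]
    split_ifs <;> simp
  · have h1 : matFun f (M * Mᴴ) * (M * Mᴴ) = M * Mᴴ := by
      conv_rhs => rw [← matFun_id hS]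
      conv_lhs => arg 2; rw [← matFun_id hS]
      rw [matFun_mul hS]
      apply matFun_congr hS
      intro i
      simp only [f]
      split_ifs with h
      · simp
      · push Not at h; simp [h]
    have h2 : ((matFun f (M * Mᴴ) * M - M) * (matFun f (M * Mᴴ) * M - M)ᴴ) = 0 := by
      rw [Matrix.conjTranspose_sub, Matrix.conjTranspose_mul, (matFun_herm hS f).eq,
        Matrix.sub_mul, Matrix.mul_sub, Matrix.mul_sub]
      have : matFun f (M * Mᴴ) * M * Mᴴ = M * Mᴴ := by rw [Matrix.mul_assoc, h1]
      rw [← Matrix.mul_assoc, ← Matrix.mul_assoc, this]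
      simp
    exact sub_eq_zero.1 (Matrix.self_mul_conjTranspose_eq_zero.1 h2)
  · have h1 : (matFun f (M * Mᴴ)).trace.re = ((M * Mᴴ).rank : ℝ) := by
      rw [matFun_trace hS, hS.rank_eq_card_non_zero_eigs, Fintype.card_subtype]
      simp [f, Finset.sum_ite]
    rw [h1, Matrix.rank_self_mul_conjTranspose]
    exact_mod_cast M.rank_le_card_width

end amp

section lattice
variable {Λ : Type*} [Fintype Λ] [DecidableEq Λ] {dloc : ℕ} {m : ℕ}

open scoped Kronecker in
lemma exists_local_proj (Adel : Finset Λ) (v : Fin m × (∀ _ : Λ, Fin dloc) → ℂ) :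
    ∃ r : Matrix (Fin m × (∀ _ : Λ, Fin dloc)) (Fin m × (∀ _ : Λ, Fin dloc)) ℂ,
      r.IsHermitian ∧ r * r = r ∧ r *ᵥ v = v ∧
      r.trace.re ≤ (dloc : ℝ) ^ (Adel.card) * (dloc : ℝ) ^ (Adel.card) ∧
      ∀ i j, SupportedOn (Finset.univ \ Adel) (blk r i j) := by
  let K : Finset Λ := Finset.univ \ Adel
  let B := ∀ _ : {k : Λ // ¬ k ∈ K}, Fin dloc
  let e : Fin m × (∀ _ : Λ, Fin dloc) ≃ (Fin m × (∀ _ : {k : Λ // k ∈ K}, Fin dloc)) × B :=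
    (Equiv.prodCongr (Equiv.refl _) (Equiv.piEquivPiSubtypeProd (fun k => k ∈ K) _)).trans
      (Equiv.prodAssoc _ _ _).symm
  let M : Matrix (Fin m × (∀ _ : {k : Λ // k ∈ K}, Fin dloc)) B ℂ :=
    Matrix.of fun s t => v (e.symm (s, t))
  obtain ⟨P, hP, hPP, hPM, hPt⟩ := exists_proj M
  have hB : Fintype.card B = dloc ^ Adel.card := by
    simp only [B, Fintype.card_pi, Fintype.card_fin, Finset.prod_const, Finset.card_univ]
    congr 1
    rw [Fintype.card_subtype]
    congr 1
    ext k
    simp [K]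
  refine ⟨(P ⊗ₖ (1 : Matrix B B ℂ)).submatrix e e, ?_, ?_, ?_, ?_, ?_⟩
  · apply Matrix.IsHermitian.submatrix
    unfold Matrix.IsHermitian
    rw [Matrix.conjTranspose_kronecker, hP.eq, Matrix.conjTranspose_one]
  · rw [Matrix.submatrix_mul_equiv, ← Matrix.mul_kronecker_mul, hPP, Matrix.one_mul]
  · funext p
    simp only [Matrix.mulVec, dotProduct, Matrix.submatrix_apply]
    rw [← e.symm.sum_comp]
    simp only [Equiv.apply_symm_apply, Fintype.sum_prod_type, Matrix.kroneckerMap_apply,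
      Matrix.one_apply, mul_ite, mul_one, mul_zero, ite_mul, zero_mul]
    have := congrFun (congrFun hPM (e p).1) (e p).2
    simp only [Matrix.mul_apply, M, Matrix.of_apply, Prod.mk.eta, Equiv.symm_apply_apply] at this
    rw [← this, Fintype.sum_prod_type]
    refine Finset.sum_congr rfl fun s _ => Finset.sum_congr rfl fun t _ => ?_
    rw [Finset.sum_eq_single (e p).2]
    · rw [if_pos rfl]
    · intro b _ hb
      rw [if_neg (Ne.symm hb)]
    · intro h
      exact absurd (Finset.mem_univ _) h
  · have : ((P ⊗ₖ (1 : Matrix B B ℂ)).submatrix e e).trace = P.trace * (dloc : ℂ) ^ Adel.card := by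
      have h1 : ((P ⊗ₖ (1 : Matrix B B ℂ)).submatrix e e).trace = (P ⊗ₖ (1 : Matrix B B ℂ)).trace :=
        e.sum_comp (fun p => (P ⊗ₖ (1 : Matrix B B ℂ)) p p)
      rw [h1, Matrix.trace_kronecker, Matrix.trace_one, hB]
      simp
    rw [this]
    have h2 : (P.trace * (dloc : ℂ) ^ Adel.card).re = P.trace.re * (dloc : ℝ) ^ Adel.card := by
      have : ((dloc : ℂ) ^ Adel.card) = (((dloc : ℝ) ^ Adel.card : ℝ) : ℂ) := by push_cast; rfl
      rw [this, Complex.re_mul_ofReal]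
    rw [h2]
    rw [hB] at hPt
    push_cast at hPt
    gcongr
  · intro i j
    refine ⟨Matrix.of fun s t => P (i, s) (j, t), ?_⟩
    ext x y
    have h3 : ((fun k : {k : Λ // ¬ k ∈ K} => x k.1) = fun k => y k.1) ↔
        ∀ k ∉ Finset.univ \ Adel, x k = y k := by
      rw [funext_iff]
      exact ⟨fun h k hk => h ⟨k, hk⟩, fun h k => h k.1 k.2⟩
    change P (i, fun k => x k.1) (j, fun k => y k.1) *
      (1 : Matrix B B ℂ) (fun k => x k.1) (fun k => y k.1) = _
    rw [Matrix.one_apply]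
    by_cases h : ∀ k ∉ Finset.univ \ Adel, x k = y k
    · rw [if_pos (h3.2 h), if_pos h, mul_one]; rfl
    · rw [if_neg (fun h' => h (h3.1 h')), if_neg h, mul_zero]

end lattice

open scoped Kronecker

/-- **Pimsner–Popa index bound for local Davies conditional expectations.** If the Davies
conditional expectation `E_A` (GNS-symmetric w.r.t. the full-rank state `σ`) acts
nontrivially only on `A∂` and satisfies `E_A(e^{−βH_{A∂}}) = e^{−βH_{A∂}}` with
`‖H_{A∂}‖_∞ ≤ gJ|A∂|`, then the complete Pimsner–Popa index satisfies
`C_cb(E_A) ≤ d^{3|A∂|}·e^{2βgJ|A∂|}`, where `d` is the local dimension. -/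
theorem stmt14 {Λ : Type*} [Fintype Λ] [DecidableEq Λ] {dloc : ℕ} (hd : 0 < dloc)
    (σ : Matrix (∀ _ : Λ, Fin dloc) (∀ _ : Λ, Fin dloc) ℂ) (hσ : σ.PosDef) (hσ1 : σ.trace = 1)
    (E F : Matrix (∀ _ : Λ, Fin dloc) (∀ _ : Λ, Fin dloc) ℂ →ₗ[ℂ]
      Matrix (∀ _ : Λ, Fin dloc) (∀ _ : Λ, Fin dloc) ℂ)
    (hE : IsGNSCondExp σ E F)
    (Adel : Finset Λ) (hloc : ActsOnlyOn Adel E)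
    (H : Matrix (∀ _ : Λ, Fin dloc) (∀ _ : Λ, Fin dloc) ℂ) (hH : H.IsHermitian)
    (hHsupp : SupportedOn Adel H)
    (β g J : ℝ) (hβ : 0 ≤ β) (hg : 0 ≤ g) (hJ : 0 ≤ J)
    (hHnorm : opNorm H ≤ g * J * Adel.card)
    (hfix : E (matExp ((-β : ℝ) • H)) = matExp ((-β : ℝ) • H)) :
    ppIndexCb E ≤ (dloc : ℝ) ^ (3 * Adel.card) * Real.exp (2 * β * g * J * Adel.card) := by
  have hEstar := E_star hE.pos
  have hFstar := F_star hE.dual hEstar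
  set b : ℝ := β * (g * J * Adel.card) with hb
  set c : ℝ := (dloc : ℝ) ^ (3 * Adel.card) * Real.exp (2 * β * g * J * Adel.card) with hc
  set G := matExp ((-β : ℝ) • H) with hG
  have hc0 : 0 ≤ c := by positivity
  have hA : ((-β : ℝ) • H).IsHermitian := by
    unfold Matrix.IsHermitian
    rw [Matrix.conjTranspose_smul, hH.eq]; simp
  have hAb : opNorm ((-β : ℝ) • H) ≤ b := by
    rw [opNorm_smul, abs_neg, abs_of_nonneg hβ]
    exact mul_le_mul_of_nonneg_left hHnorm hβ
  obtain ⟨hGl, hGu⟩ := matExp_bounds hA hAb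
  have hFfix : ∀ Y, SupportedOn (Finset.univ \ Adel) Y → F Y = Y := by
    intro Y hY
    rw [Matrix.ext_iff_trace_mul_left]
    intro X
    rw [← hE.dual, ← (hloc Y hY X).2, hE.tracePreserving]
  refine ciSup_le fun m => ?_
  refine csInf_le ⟨0, fun x hx => hx.1⟩ ⟨hc0, fun ρ hρ => ?_⟩
  have hcast : c • amplify m E ρ - ρ = (c : ℂ) • ampLin m E ρ - ρ := by
    ext i j
    simp [ampLin]
  rw [hcast]
  refine Matrix.PosSemidef.of_dotProduct_mulVec_nonneg ?_ ?_
  · have h2 : ((c : ℂ) • ampLin m E ρ).IsHermitian := by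
      unfold Matrix.IsHermitian
      rw [Matrix.conjTranspose_smul, ← amp_star E hEstar, hρ.1.1.eq]; simp
    exact h2.sub hρ.1.1
  intro v
  obtain ⟨r, hr, hrr, hrv, hrt, hrs⟩ := exists_local_proj Adel v
  set q := Matrix.vecMulVec v (star v) with hq
  have hqp : q.PosSemidef := Matrix.posSemidef_vecMulVec_self_star v
  have hrq : r * q = q := by rw [hq, Matrix.mul_vecMulVec, hrv]
  have hqr : q * r = q := by
    have := congrArg Matrix.conjTranspose hrq
    rwa [Matrix.conjTranspose_mul, hqp.1.eq, hr.eq] at this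
  have hFr : ampLin m F r = r := by
    refine blk_ext fun i j => ?_
    rw [blk_ampLin, hFfix _ (hrs i j)]
  have hGl' : (((1 : Matrix (Fin m) (Fin m) ℂ) ⊗ₖ G) - ((Real.exp (-b) : ℝ) : ℂ) • 1).PosSemidef := by
    have := (Matrix.PosSemidef.one (n := Fin m) (R := ℂ)).kronecker hGl
    rwa [kron_sub, Matrix.kronecker_smul, Matrix.one_kronecker_one] at this
  have hGu' : (((Real.exp b : ℝ) : ℂ) • 1 - ((1 : Matrix (Fin m) (Fin m) ℂ) ⊗ₖ G)).PosSemidef := by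
    have := (Matrix.PosSemidef.one (n := Fin m) (R := ℂ)).kronecker hGu
    rwa [kron_sub, Matrix.kronecker_smul, Matrix.one_kronecker_one] at this
  have hD : (1 : ℝ) ≤ (dloc : ℝ) ^ Adel.card := one_le_pow₀ (by exact_mod_cast hd)
  have hcc : Real.exp b * r.trace.re ≤ Real.exp (-b) * c := by
    have e1 : Real.exp (-b) * c = Real.exp b * ((dloc : ℝ) ^ Adel.card) ^ 3 := by
      have : Real.exp b = Real.exp (-b) * Real.exp (2 * β * g * J * Adel.card) := by
        rw [← Real.exp_add]; congr 1; rw [hb]; ring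
      rw [this, hc, mul_comm 3, pow_mul]; ring
    rw [e1]
    refine mul_le_mul_of_nonneg_left (hrt.trans ?_) (Real.exp_pos _).le
    nlinarith [mul_le_mul_of_nonneg_left hD (sq_nonneg ((dloc : ℝ) ^ Adel.card))]
  have key := core (ampLin m F) (amp_one F hE.unital) (amp_star F hFstar)
    (amp_bimodule F hE.bimodule) _ _ _ c (Real.exp_pos (-b)) hGl' hGu'
    (amp_trace hE.dual hfix) q r hqp hr hrr hFr hrq hqr hcc
  have h1 := trace_mul_nonneg hρ.1 key
  have h2 : star v ⬝ᵥ (((c : ℂ) • ampLin m E ρ - ρ) *ᵥ v) =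
      (ρ * ((c : ℂ) • ampLin m F q - q)).trace := by
    have h3 : star v ⬝ᵥ (((c : ℂ) • ampLin m E ρ - ρ) *ᵥ v) =
        (((c : ℂ) • ampLin m E ρ - ρ) * q).trace := by
      rw [hq, Matrix.mul_vecMulVec, Matrix.trace_vecMulVec, dotProduct_comm]
    rw [h3, Matrix.sub_mul, Matrix.mul_sub, Matrix.trace_sub, Matrix.trace_sub, Matrix.smul_mul,
      Matrix.mul_smul, Matrix.trace_smul, Matrix.trace_smul, amp_dual hE.dual]
  rw [h2]
  exact h1

end Paper
end
end
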